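/- For every δ > 0 there exists τ > 0 such that for every ν > 0 and every ε > 0 there exists n₀ ∈ ℕ such that the following holds for every even n ≥ n₀, every integer d ≥ δn, and every positive integer r ≤ n^{1/50}: if G is a d-regular robust (ν,τ)-expander on n vertices, N is a spanning r-regular subgraph of G, M is a uniformly random perfect matching of G, X := |M ∩ E(N)|, and Y is a Poisson random variable with parameter rn/(2d), then d_TV(X,Y) ≤ ε. -/

import Mathlib

open Finset

namespace RPM

/-- The `ν`-robust neighbourhood of a vertex set `S` in a graph `G` on `n` vertices:
all vertices having at least `ν * n` neighbours in `S`. -/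
def RN {V : Type*} [Fintype V] (G : SimpleGraph V) (ν : ℝ) (S : Set V) : Set V :=
  {v : V | ν * (Fintype.card V : ℝ) ≤ (Nat.card {u : V | u ∈ S ∧ G.Adj v u} : ℝ)}

/-- `G` is a robust `(ν, τ)`-expander. -/
def RobustExpander {V : Type*} [Fintype V] (G : SimpleGraph V) (ν τ : ℝ) : Prop :=
  ∀ S : Set V,
    τ * (Fintype.card V : ℝ) ≤ (Nat.card S : ℝ) →
    (Nat.card S : ℝ) ≤ (1 - τ) * (Fintype.card V : ℝ) →
    (Nat.card S : ℝ) + ν * (Fintype.card V : ℝ) ≤ (Nat.card (RN G ν S) : ℝ)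

/-- `M` (a set of edges) is a perfect matching of `G`: its edges are edges of `G`,
and every vertex lies in exactly one edge of `M` (in particular the edges are
pairwise disjoint and cover all vertices). -/
def IsPM {V : Type*} (G : SimpleGraph V) (M : Finset (Sym2 V)) : Prop :=
  (∀ e ∈ M, e ∈ G.edgeSet) ∧ ∀ v : V, ∃! e, e ∈ M ∧ v ∈ e

/-- The number of perfect matchings of `G`. -/
noncomputable def pmCount {V : Type*} (G : SimpleGraph V) : ℕ :=
  Nat.card {M : Finset (Sym2 V) // IsPM G M}

/-- `N` (a set of edges) is a matching in `G`: edges of `G`, pairwise disjoint. -/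
def IsMatchingIn {V : Type*} (G : SimpleGraph V) (N : Finset (Sym2 V)) : Prop :=
  (∀ e ∈ N, e ∈ G.edgeSet) ∧ ∀ e ∈ N, ∀ f ∈ N, e ≠ f → ∀ v : V, v ∈ e → v ∉ f

/-- `G` is `d`-regular: every vertex has exactly `d` neighbours. -/
def RegularDeg {V : Type*} (G : SimpleGraph V) (d : ℕ) : Prop :=
  ∀ v : V, Nat.card {u : V | G.Adj v u} = d

/-- Probability that a uniformly random perfect matching of `G` contains the edge `e`. -/
noncomputable def edgeProb {V : Type*} (G : SimpleGraph V) (e : Sym2 V) : ℝ :=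
  (Nat.card {M : Finset (Sym2 V) // IsPM G M ∧ e ∈ M} : ℝ) / (pmCount G : ℝ)

/-- `P[X = k]` where `X = |M ∩ N|` for a uniformly random perfect matching `M` of `G`. -/
noncomputable def interProb {V : Type*} [DecidableEq V] (G : SimpleGraph V)
    (N : Finset (Sym2 V)) (k : ℕ) : ℝ :=
  (Nat.card {M : Finset (Sym2 V) // IsPM G M ∧ (M ∩ N).card = k} : ℝ) / (pmCount G : ℝ)

/-- The Poisson probability mass function with parameter `lam`. -/
noncomputable def poissonPMF (lam : ℝ) (k : ℕ) : ℝ :=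
  Real.exp (-lam) * lam ^ k / (Nat.factorial k)

/-- `N` (a set of edges) is a spanning `r`-regular subgraph of `G`: all edges of `N`
are edges of `G` and every vertex lies in exactly `r` edges of `N`. -/
def SpanningRegular {V : Type*} (G : SimpleGraph V) (N : Finset (Sym2 V)) (r : ℕ) : Prop :=
  (∀ e ∈ N, e ∈ G.edgeSet) ∧ ∀ v : V, Nat.card {e : Sym2 V // e ∈ N ∧ v ∈ e} = r

section Mixing

variable {V : Type*} [Fintype V] [DecidableEq V]

lemma pow_row_sum {D : Matrix V V ℝ} {d : ℝ} (hrow : ∀ x, ∑ y, D x y = d) (s : ℕ) (x : V) :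
    ∑ y, (D ^ s) x y = d ^ s := by
  induction s generalizing x with
  | zero => simp [Matrix.one_apply]
  | succ s ih =>
    simp_rw [pow_succ', Matrix.mul_apply]
    rw [sum_comm]
    simp_rw [← mul_sum, ih, ← sum_mul, hrow]

lemma pow_col_sum {D : Matrix V V ℝ} {d : ℝ} (hcol : ∀ y, ∑ x, D x y = d) (s : ℕ) (y : V) :
    ∑ x, (D ^ s) x y = d ^ s := by
  induction s generalizing y with
  | zero => simp [Matrix.one_apply]
  | succ s ih =>
    simp_rw [pow_succ, Matrix.mul_apply]
    rw [sum_comm]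
    simp_rw [← sum_mul, ih, ← mul_sum, hcol]

lemma pow_entry_nonneg {D : Matrix V V ℝ} (hD : ∀ x y, 0 ≤ D x y) (s : ℕ) (x y : V) :
    0 ≤ (D ^ s) x y := by
  induction s generalizing y with
  | zero => by_cases h : x = y <;> simp [h]
  | succ s ih =>
    rw [pow_succ, Matrix.mul_apply]
    exact sum_nonneg fun z _ => mul_nonneg (ih z) (hD z y)

/-- One contraction step: multiplying a power of a matrix with constant row and column sums `d`
by a matrix bounded below contracts the distance to the uniform matrix. -/
lemma deviation_mul {D : Matrix V V ℝ} {d : ℝ} (hrow : ∀ x, ∑ y, D x y = d)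
    (hcol : ∀ y, ∑ x, D x y = d) {j t : ℕ} {c B : ℝ}
    (hlow : ∀ x y, c * d ^ j / Fintype.card V ≤ (D ^ j) x y)
    (hB : ∀ x y, |(D ^ t) x y - d ^ t / Fintype.card V| ≤ B) (x y : V) :
    |(D ^ (j + t)) x y - d ^ (j + t) / Fintype.card V| ≤ (1 - c) * d ^ j * B := by
  have hn : (Fintype.card V : ℝ) ≠ 0 := by
    have : Nonempty V := ⟨x⟩
    exact_mod_cast Fintype.card_ne_zero
  set n : ℝ := (Fintype.card V : ℝ) with hn_def
  have hzero : ∑ z, ((D ^ t) z y - d ^ t / n) = 0 := by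
    rw [sum_sub_distrib, pow_col_sum hcol, sum_const, card_univ, nsmul_eq_mul, ← hn_def]
    field_simp
    ring
  have hkey : (D ^ (j + t)) x y - d ^ (j + t) / n =
      ∑ z, ((D ^ j) x z - c * d ^ j / n) * ((D ^ t) z y - d ^ t / n) := by
    simp_rw [sub_mul _ (c * d ^ j / n), sum_sub_distrib, ← mul_sum, hzero, mul_sub, sum_sub_distrib,
      ← sum_mul, pow_row_sum hrow, pow_add, Matrix.mul_apply]
    ring
  rw [hkey]
  calc |∑ z, ((D ^ j) x z - c * d ^ j / n) * ((D ^ t) z y - d ^ t / n)|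
      ≤ ∑ z, ((D ^ j) x z - c * d ^ j / n) * B := by
        refine (abs_sum_le_sum_abs _ _).trans (sum_le_sum fun z _ => ?_)
        rw [abs_mul, abs_of_nonneg (sub_nonneg.2 (hlow x z))]
        exact mul_le_mul_of_nonneg_left (hB z y) (sub_nonneg.2 (hlow x z))
    _ = (1 - c) * d ^ j * B := by
        rw [← sum_mul, sum_sub_distrib, pow_row_sum hrow, sum_const, card_univ, nsmul_eq_mul,
          ← hn_def]
        field_simp

/-- Doeblin's bound: if some power of a matrix with constant row and column sums is bounded below
entrywise, then its powers converge geometrically to the uniform matrix. -/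
lemma abs_pow_sub_le {D : Matrix V V ℝ} {d : ℝ} (hD : ∀ x y, 0 ≤ D x y)
    (hrow : ∀ x, ∑ y, D x y = d) (hcol : ∀ y, ∑ x, D x y = d) {k : ℕ} {c : ℝ}
    (hlow : ∀ x y, c * d ^ k / Fintype.card V ≤ (D ^ k) x y) (s : ℕ) (x y : V) :
    |(D ^ s) x y - d ^ s / Fintype.card V| ≤ d ^ s * (1 - c) ^ (s / k) := by
  have hmul : ∀ t : ℕ, ∀ x y,
      |(D ^ (k * t)) x y - d ^ (k * t) / Fintype.card V| ≤ d ^ (k * t) * (1 - c) ^ t := by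
    intro t
    induction t with
    | zero =>
      intro x y
      have : Nonempty V := ⟨x⟩
      have hn : (1 : ℝ) ≤ Fintype.card V := by
        exact_mod_cast Nat.one_le_iff_ne_zero.2 Fintype.card_ne_zero
      have h1 : (1 : ℝ) / Fintype.card V ≤ 1 := by
        rw [div_le_one (by linarith)]; exact hn
      have h0 : (0 : ℝ) ≤ 1 / Fintype.card V := by positivity
      by_cases h : x = y
      · simp only [mul_zero, pow_zero, Matrix.one_apply, h, if_true, mul_one]
        rw [abs_le]; constructor <;> linarith
      · simp only [mul_zero, pow_zero, Matrix.one_apply, h, if_false, mul_one]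
        rw [abs_le]; constructor <;> linarith
    | succ t ih =>
      intro x y
      have := deviation_mul hrow hcol hlow ih x y
      rw [show k * (t + 1) = k + k * t by ring]
      refine this.trans (le_of_eq ?_)
      ring
  have hzero : ∀ x y, (0 : ℝ) * d ^ (s % k) / Fintype.card V ≤ (D ^ (s % k)) x y := by
    intro x y
    simpa using pow_entry_nonneg hD (s % k) x y
  have := deviation_mul hrow hcol hzero (hmul (s / k)) x y
  rw [Nat.mod_add_div] at this
  refine this.trans (le_of_eq ?_)
  conv_rhs => rw [← Nat.mod_add_div s k, pow_add]
  rw [Nat.mod_add_div]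
  ring

end Mixing

section Walks
open scoped Classical

variable {V : Type*} [Fintype V] [DecidableEq V]

/-- Transition matrix of the alternating walk which follows an edge of `G` and then applies
the matching `m`. -/
noncomputable def walkMatrix (G : SimpleGraph V) (m : Equiv.Perm V) : Matrix V V ℝ :=
  Matrix.of fun x y => if G.Adj x (m y) then 1 else 0

lemma walkMatrix_apply (G : SimpleGraph V) (m : Equiv.Perm V) (x y : V) :
    walkMatrix G m x y = if G.Adj x (m y) then 1 else 0 := rfl

lemma walkMatrix_nonneg (G : SimpleGraph V) (m : Equiv.Perm V) (x y : V) :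
    0 ≤ walkMatrix G m x y := by
  rw [walkMatrix_apply]; split_ifs <;> norm_num

lemma walkMatrix_row_sum {G : SimpleGraph V} {d : ℕ} (hd : ∀ v, #{u | G.Adj v u} = d)
    (m : Equiv.Perm V) (x : V) : ∑ y, walkMatrix G m x y = d := by
  simp_rw [walkMatrix_apply]
  rw [Equiv.sum_comp m (fun y => if G.Adj x y then (1 : ℝ) else 0), sum_boole, hd]

lemma walkMatrix_col_sum {G : SimpleGraph V} {d : ℕ} (hd : ∀ v, #{u | G.Adj v u} = d)
    (m : Equiv.Perm V) (y : V) : ∑ x, walkMatrix G m x y = d := by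
  simp_rw [walkMatrix_apply, G.adj_comm _ (m y)]
  rw [sum_boole, hd]

/-- Robust expansion spreads the alternating walk: the set of starting points from which `y` is
reached in many ways keeps growing until it is everything. -/
lemma card_walkMatrix_pow_ge {G : SimpleGraph V} {d : ℕ} (hd : ∀ v, #{u | G.Adj v u} = d)
    (m : Equiv.Perm V) {ν τ : ℝ} (hν : 0 ≤ ν) (hτ : τ * Fintype.card V ≤ d)
    (hexp : ∀ S : Finset V, τ * Fintype.card V ≤ #S →
      min (Fintype.card V : ℝ) (#S + ν * Fintype.card V) ≤
        #{v | ν * Fintype.card V ≤ (#{u ∈ S | G.Adj v u} : ℝ)}) (y : V) (i : ℕ) :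
    τ * Fintype.card V ≤ (#{x | (ν * Fintype.card V) ^ i ≤ (walkMatrix G m ^ (i + 1)) x y} : ℝ) ∧
    min (Fintype.card V : ℝ) (i * (ν * Fintype.card V)) ≤
      #{x | (ν * Fintype.card V) ^ i ≤ (walkMatrix G m ^ (i + 1)) x y} := by
  have hνn : 0 ≤ ν * Fintype.card V := by positivity
  induction i with
  | zero =>
    constructor
    · refine hτ.trans ?_
      rw [← hd (m y)]
      norm_cast
      refine card_le_card fun x hx => ?_
      simp only [mem_filter, mem_univ, true_and] at hx ⊢
      simp [walkMatrix_apply, hx.symm]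
    · simp
  | succ i ih =>
    set S : Finset V := {x | (ν * Fintype.card V) ^ i ≤ (walkMatrix G m ^ (i + 1)) x y} with hS
    have hmS : #(S.image m) = #S := card_image_of_injective _ m.injective
    have hτn : τ * Fintype.card V ≤ Fintype.card V := by
      refine hτ.trans ?_
      rw [← hd y]
      exact_mod_cast card_le_univ _
    have h1 := hexp (S.image m) (by rw [hmS]; exact ih.1)
    rw [hmS] at h1
    have hsub : ({v | ν * Fintype.card V ≤ (#{u ∈ S.image m | G.Adj v u} : ℝ)} : Finset V) ⊆
        ({x | (ν * Fintype.card V) ^ (i + 1) ≤ (walkMatrix G m ^ (i + 1 + 1)) x y} : Finset V) := by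
      intro x hx
      simp only [mem_filter, mem_univ, true_and] at hx ⊢
      have hle : ((#{u ∈ S.image m | G.Adj x u} : ℕ) : ℝ) ≤ #{z ∈ S | G.Adj x (m z)} := by
        rw [filter_image]
        exact_mod_cast card_image_le
      calc (ν * Fintype.card V : ℝ) ^ (i + 1)
          ≤ #{z ∈ S | G.Adj x (m z)} * (ν * Fintype.card V : ℝ) ^ i := by
            rw [pow_succ']
            exact mul_le_mul_of_nonneg_right (hx.trans hle) (by positivity)
        _ = ∑ z ∈ S with G.Adj x (m z), (ν * Fintype.card V : ℝ) ^ i := by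
            rw [sum_const, nsmul_eq_mul]
        _ ≤ ∑ z ∈ S with G.Adj x (m z), walkMatrix G m x z * (walkMatrix G m ^ (i + 1)) z y := by
            refine sum_le_sum fun z hz => ?_
            rw [mem_filter] at hz
            rw [walkMatrix_apply, if_pos hz.2, one_mul]
            simpa [hS] using hz.1
        _ ≤ ∑ z, walkMatrix G m x z * (walkMatrix G m ^ (i + 1)) z y :=
            sum_le_univ_sum_of_nonneg fun z =>
              mul_nonneg (walkMatrix_nonneg _ _ _ _) (pow_entry_nonneg (walkMatrix_nonneg _ _) _ _ _)
        _ = (walkMatrix G m ^ (i + 1 + 1)) x y := by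
            rw [pow_succ' _ (i + 1), Matrix.mul_apply]
    have h2 := h1.trans (Nat.cast_le.2 (card_le_card hsub))
    refine ⟨le_trans (le_min hτn ?_) h2, le_trans ?_ h2⟩
    · linarith [ih.1]
    · refine le_min (min_le_left _ _) ?_
      push_cast
      rcases min_le_iff.1 ih.2 with h | h
      · exact (min_le_left _ _).trans (by linarith)
      · exact (min_le_right _ _).trans (by linarith)

/-- Rapid mixing of the alternating walk in a dense regular robust expander. -/
lemma walkMatrix_mixing {G : SimpleGraph V} {d : ℕ} (hd : ∀ v, #{u | G.Adj v u} = d)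
    (m : Equiv.Perm V) {ν τ : ℝ} (hν : 0 < ν) (hτ : τ * Fintype.card V ≤ d)
    (hexp : ∀ S : Finset V, τ * Fintype.card V ≤ #S →
      min (Fintype.card V : ℝ) (#S + ν * Fintype.card V) ≤
        #{v | ν * Fintype.card V ≤ (#{u ∈ S | G.Adj v u} : ℝ)})
    {i : ℕ} (hi : 1 ≤ i * ν) (s : ℕ) (x y : V) :
    |(walkMatrix G m ^ s) x y - (d : ℝ) ^ s / Fintype.card V| ≤
      (d : ℝ) ^ s * (1 - ν ^ i) ^ (s / (i + 1)) := by
  refine abs_pow_sub_le (walkMatrix_nonneg G m) (walkMatrix_row_sum hd m)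
    (walkMatrix_col_sum hd m) (fun x y => ?_) s x y
  have : Nonempty V := ⟨x⟩
  have hn : (0 : ℝ) < Fintype.card V := by exact_mod_cast Fintype.card_pos
  have h := (card_walkMatrix_pow_ge hd m hν.le hτ hexp y i).2
  have hmin : min (Fintype.card V : ℝ) (i * (ν * Fintype.card V)) = Fintype.card V := by
    refine min_eq_left ?_
    nlinarith
  rw [hmin] at h
  have huniv : ({x | (ν * Fintype.card V) ^ i ≤ (walkMatrix G m ^ (i + 1)) x y} : Finset V) =
      univ := by
    rw [← card_eq_iff_eq_univ]
    exact le_antisymm (card_le_univ _) (by exact_mod_cast h)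
  have hx : x ∈ ({x | (ν * Fintype.card V) ^ i ≤ (walkMatrix G m ^ (i + 1)) x y} : Finset V) := by
    rw [huniv]; exact mem_univ x
  simp only [mem_filter, mem_univ, true_and] at hx
  refine le_trans ?_ hx
  have hdn : (d : ℝ) ≤ Fintype.card V := by
    rw [← hd x]; exact_mod_cast card_le_univ _
  rw [div_le_iff₀ hn, mul_pow, mul_assoc]
  rw [← pow_succ]
  gcongr

end Walks

section Counting
open scoped Classical

variable {V : Type*} [Fintype V] [DecidableEq V]

/-- Sequences built entry by entry, each entry being chosen from a set depending only on the
earlier entries, are at most as many as the product of the numbers of choices. -/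
lemma card_le_prod_choices {n : ℕ} (S : Finset (Fin n → V)) (C : Fin n → (Fin n → V) → Finset V)
    (c : Fin n → ℕ) (hmem : ∀ x ∈ S, ∀ i, x i ∈ C i x)
    (hloc : ∀ i x y, (∀ j < i, x j = y j) → C i x = C i y)
    (hcard : ∀ x ∈ S, ∀ i, #(C i x) ≤ c i) : #S ≤ ∏ i, c i := by
  induction n with
  | zero => simpa using card_le_univ S
  | succ n ih =>
    rw [Fin.prod_univ_castSucc, mul_comm]
    rcases S.eq_empty_or_nonempty with rfl | ⟨x₀, hx₀⟩
    · simp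
    have himg : #(S.image Fin.init) ≤ ∏ i : Fin n, c i.castSucc := by
      refine ih (S.image Fin.init) (fun i x => C i.castSucc (Fin.snoc x (x₀ (Fin.last n))))
        (fun i => c i.castSucc) ?_ ?_ ?_
      · intro x hx i
        obtain ⟨y, hy, rfl⟩ := mem_image.1 hx
        rw [hloc i.castSucc _ y]
        · exact hmem y hy i.castSucc
        · intro j hj
          have hj' : j.val < n := lt_trans hj i.isLt
          have : j = Fin.castSucc ⟨j, hj'⟩ := rfl
          rw [this, Fin.snoc_castSucc]
          rfl
      · intro i x y hxy
        refine hloc _ _ _ fun j hj => ?_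
        have hj' : j.val < n := lt_trans hj i.isLt
        have : j = Fin.castSucc ⟨j, hj'⟩ := rfl
        rw [this, Fin.snoc_castSucc, Fin.snoc_castSucc]
        exact hxy _ hj
      · intro x hx i
        obtain ⟨y, hy, rfl⟩ := mem_image.1 hx
        rw [hloc i.castSucc _ y]
        · exact hcard y hy i.castSucc
        · intro j hj
          have hj' : j.val < n := lt_trans hj i.isLt
          have : j = Fin.castSucc ⟨j, hj'⟩ := rfl
          rw [this, Fin.snoc_castSucc]
          rfl
    refine (card_le_mul_card_image (f := Fin.init) S (c (Fin.last n)) ?_).trans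
      (Nat.mul_le_mul_left _ himg)
    intro z hz
    obtain ⟨y, hy, rfl⟩ := mem_image.1 hz
    refine le_trans ?_ (hcard y hy (Fin.last n))
    refine card_le_card_of_injOn (fun x => x (Fin.last n)) ?_ ?_
    · intro x hx
      rw [mem_coe, mem_filter] at hx
      have := hmem x hx.1 (Fin.last n)
      rw [hloc (Fin.last n) x y] at this
      · exact this
      · intro j hj
        have : j = Fin.castSucc ⟨j, hj⟩ := rfl
        rw [this]
        exact congrFun hx.2 ⟨j, hj⟩
    · intro x hx x' hx' h
      rw [mem_coe, mem_filter] at hx hx'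
      rw [← Fin.snoc_init_self x, ← Fin.snoc_init_self x', hx.2, hx'.2]
      simp only at h
      rw [h]

/-- Entries of matrix powers count paths. -/
lemma card_paths {R : V → V → Prop} {D : Matrix V V ℝ} (hDR : ∀ x y, D x y = if R x y then 1 else 0)
    (s : ℕ) (a b : V) :
    (#{x : Fin (s + 1) → V | x 0 = a ∧ x (Fin.last s) = b ∧
      ∀ i : Fin s, R (x i.castSucc) (x i.succ)} : ℝ) = (D ^ s) a b := by
  induction s generalizing a with
  | zero =>
    by_cases h : a = b
    · subst h
      have : ({x : Fin (0 + 1) → V | x 0 = a ∧ x (Fin.last 0) = a ∧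
        ∀ i : Fin 0, R (x i.castSucc) (x i.succ)} : Finset _) = {fun _ => a} := by
        ext x
        simp only [mem_filter, mem_univ, true_and, mem_singleton]
        constructor
        · rintro ⟨h, -⟩; ext i; rw [Fin.fin_one_eq_zero i, h]
        · rintro rfl; exact ⟨rfl, rfl, fun i => i.elim0⟩
      rw [this]; simp
    · have : ({x : Fin (0 + 1) → V | x 0 = a ∧ x (Fin.last 0) = b ∧
        ∀ i : Fin 0, R (x i.castSucc) (x i.succ)} : Finset _) = ∅ := by
        ext x
        simp only [mem_filter, mem_univ, true_and, notMem_empty, iff_false]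
        rintro ⟨h1, h2, -⟩
        exact h (h1.symm.trans h2)
      rw [this]; simp [h]
  | succ s ih =>
    rw [pow_succ', Matrix.mul_apply]
    have hterm : ∀ z, D a z * (D ^ s) z b = (#{x : Fin (s + 2) → V | (x 0 = a ∧
        x (Fin.last (s + 1)) = b ∧ ∀ i : Fin (s + 1), R (x i.castSucc) (x i.succ)) ∧
        x 1 = z} : ℝ) := by
      intro z
      rw [hDR, ← ih z]
      by_cases h : R a z
      · rw [if_pos h, one_mul]
        norm_cast
        refine card_bij' (fun x _ => Fin.cons a x) (fun x _ => Fin.tail x) ?_ ?_ ?_ ?_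
        · intro x hx
          simp only [mem_filter, mem_univ, true_and] at hx ⊢
          obtain ⟨h0, h1, h2⟩ := hx
          refine ⟨⟨rfl, ?_, ?_⟩, ?_⟩
          · rw [← h1, ← Fin.succ_last, Fin.cons_succ]
          · intro i
            refine Fin.cases ?_ (fun i => ?_) i
            · simpa [h0] using h
            · rw [← Fin.succ_castSucc, Fin.cons_succ, Fin.cons_succ]; exact h2 i
          · rw [← h0]; rfl
        · intro x hx
          simp only [mem_filter, mem_univ, true_and] at hx ⊢
          obtain ⟨⟨h0, h1, h2⟩, h3⟩ := hx
          refine ⟨h3, h1, fun i => ?_⟩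
          have := h2 i.succ
          rwa [← Fin.succ_castSucc] at this
        · intro x hx; simp
        · intro x hx
          simp only [mem_filter, mem_univ, true_and] at hx
          rw [← hx.1.1, Fin.cons_self_tail]
      · rw [if_neg h, zero_mul, eq_comm, Nat.cast_eq_zero, card_eq_zero]
        ext x
        simp only [mem_filter, mem_univ, true_and, notMem_empty, iff_false]
        rintro ⟨⟨h0, h1, h2⟩, h3⟩
        refine h ?_
        have := h2 0
        rw [← h0, ← h3]
        exact this
    simp_rw [hterm]
    rw [← Nat.cast_sum]
    norm_cast
    rw [card_eq_sum_card_fiberwise (f := fun x : Fin (s + 2) → V => x 1) (t := univ)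
      (fun x _ => mem_coe.2 (mem_univ _))]
    simp_rw [filter_filter]

/-- Closed paths through a given vertex. -/
lemma card_closed_paths {R : V → V → Prop} {D : Matrix V V ℝ}
    (hDR : ∀ x y, D x y = if R x y then 1 else 0) (s : ℕ) (a : V) :
    (#{x : Fin (s + 1) → V | x 0 = a ∧ ∀ i : Fin (s + 1), R (x i) (x (i + 1))} : ℝ) =
      (D ^ (s + 1)) a a := by
  have hsnoc : ∀ (x : Fin (s + 1) → V) (i : Fin (s + 1)),
      Fin.snoc (α := fun _ => V) x (x 0) i.succ = x (i + 1) := by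
    intro x i
    refine Fin.lastCases ?_ (fun i => ?_) i
    · rw [Fin.succ_last, Fin.snoc_last, Fin.last_add_one]
    · rw [Fin.succ_castSucc, Fin.snoc_castSucc, Fin.coeSucc_eq_succ]
  rw [← card_paths hDR (s + 1) a a]
  norm_cast
  refine card_bij' (fun x _ => Fin.snoc x (x 0)) (fun x _ => Fin.init x) ?_ ?_ ?_ ?_
  · intro x hx
    simp only [mem_filter, mem_univ, true_and] at hx ⊢
    refine ⟨hx.1, by rw [Fin.snoc_last, hx.1], fun i => ?_⟩
    rw [hsnoc, Fin.snoc_castSucc]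
    exact hx.2 i
  · intro x hx
    simp only [mem_filter, mem_univ, true_and] at hx ⊢
    obtain ⟨h0, h1, h2⟩ := hx
    refine ⟨h0, fun i => ?_⟩
    have h3 : Fin.snoc (α := fun _ => V) (Fin.init x) (Fin.init x 0) = x := by
      conv_rhs => rw [← Fin.snoc_init_self x, h1, ← h0]
      rfl
    rw [← hsnoc (Fin.init x) i, h3]
    exact h2 i
  · intro x hx; simp
  · intro x hx
    simp only [mem_filter, mem_univ, true_and] at hx
    obtain ⟨h0, h1, h2⟩ := hx
    conv_rhs => rw [← Fin.snoc_init_self x, h1, ← h0]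
    rfl

/-- Closed paths through a given pair of consecutive vertices. -/
lemma card_closed_paths_two {R : V → V → Prop} {D : Matrix V V ℝ}
    (hDR : ∀ x y, D x y = if R x y then 1 else 0) (s : ℕ) {a b : V} (hab : R a b) :
    (#{x : Fin (s + 2) → V | x 0 = a ∧ x 1 = b ∧ ∀ i : Fin (s + 2), R (x i) (x (i + 1))} : ℝ) =
      (D ^ (s + 1)) b a := by
  rw [← card_paths hDR (s + 1) b a]
  norm_cast
  refine card_bij' (fun x _ j => x (j + 1)) (fun x _ j => x (j - 1)) ?_ ?_ ?_ ?_
  · intro x hx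
    simp only [mem_filter, mem_univ, true_and] at hx ⊢
    obtain ⟨h0, h1, h2⟩ := hx
    refine ⟨by rw [zero_add, h1], by rw [Fin.last_add_one, h0], fun i => ?_⟩
    rw [Fin.coeSucc_eq_succ]
    exact h2 i.succ
  · intro x hx
    simp only [mem_filter, mem_univ, true_and] at hx ⊢
    obtain ⟨h0, h1, h2⟩ := hx
    have hlast : (0 : Fin (s + 2)) - 1 = Fin.last (s + 1) := by
      rw [sub_eq_iff_eq_add, Fin.last_add_one]
    refine ⟨by rw [hlast, h1], by rw [sub_self, h0], fun i => ?_⟩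
    rw [add_sub_cancel_right]
    refine Fin.cases ?_ (fun i => ?_) i
    · rw [hlast, h1, h0]; exact hab
    · rw [← Fin.coeSucc_eq_succ, add_sub_cancel_right, Fin.coeSucc_eq_succ]; exact h2 i
  · intro x hx; simp
  · intro x hx; simp

end Counting

section Switching
open scoped Classical

variable {V : Type*} [Fintype V] [DecidableEq V]

/-- The vertices whose matching edge lies in `H`. -/
noncomputable def hit (H : SimpleGraph V) (m : Equiv.Perm V) : Finset V :=
  {v | H.Adj v (m v)}

/-- The involutions corresponding to perfect matchings of `G`. -/
noncomputable def pmPerms (G : SimpleGraph V) : Finset (Equiv.Perm V) :=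
  {m | (∀ v, m (m v) = v) ∧ ∀ v, G.Adj v (m v)}

lemma mem_hit {H : SimpleGraph V} {m : Equiv.Perm V} {v : V} : v ∈ hit H m ↔ H.Adj v (m v) := by
  simp [hit]

lemma mem_pmPerms {G : SimpleGraph V} {m : Equiv.Perm V} :
    m ∈ pmPerms G ↔ (∀ v, m (m v) = v) ∧ ∀ v, G.Adj v (m v) := by
  simp [pmPerms]

lemma apply_mem_hit {H : SimpleGraph V} {m : Equiv.Perm V} (hm : ∀ v, m (m v) = v) {v : V} :
    m v ∈ hit H m ↔ v ∈ hit H m := by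
  rw [mem_hit, mem_hit, hm, H.adj_comm]

/-- Closed alternating walks: `x i` is joined by an edge of `G` to the partner of `x (i + 1)`. -/
def IsClosedWalk (G : SimpleGraph V) (m : Equiv.Perm V) {s : ℕ} (x : Fin (s + 2) → V) : Prop :=
  ∀ i, G.Adj (x i) (m (x (i + 1)))

/-- Values of `x j` for which the closed alternating walk meets its past or interferes
with `H`. -/
noncomputable def forbidden (H : SimpleGraph V) (m : Equiv.Perm V) {s : ℕ} (x : Fin (s + 2) → V)
    (j : Fin (s + 2)) : Finset V :=
  (univ.filter (· < j)).image x ∪ (univ.filter (· < j)).image (fun i => m (x i)) ∪ hit H m ∪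
    univ.filter (fun v => H.Adj (x (j - 1)) (m v)) ∪ univ.filter (fun v => H.Adj v (m (x 0)))

lemma card_forbidden_le {H : SimpleGraph V} {r : ℕ} (hr : ∀ v, #{u | H.Adj v u} ≤ r)
    (m : Equiv.Perm V) {s : ℕ} (x : Fin (s + 2) → V) (j : Fin (s + 2)) :
    #(forbidden H m x j) ≤ 2 * (s + 2) + #(hit H m) + 2 * r := by
  have h0 : #(univ.filter (· < j)) ≤ s + 2 := by
    simpa using card_le_univ (univ.filter (· < j))
  have h1 : #((univ.filter (· < j)).image x) ≤ s + 2 := card_image_le.trans h0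
  have h2 : #((univ.filter (· < j)).image (fun i => m (x i))) ≤ s + 2 := card_image_le.trans h0
  have h3 : #(univ.filter (fun v => H.Adj (x (j - 1)) (m v))) ≤ r := by
    refine le_trans ?_ (hr (x (j - 1)))
    refine card_le_card_of_injOn m ?_ m.injective.injOn
    intro v hv
    simpa using hv
  have h4 : #(univ.filter (fun v => H.Adj v (m (x 0)))) ≤ r := by
    simp_rw [H.adj_comm _ (m (x 0))]
    exact hr _
  unfold forbidden
  refine (card_union_le _ _).trans ?_
  have h5 := card_union_le ((univ.filter (· < j)).image x ∪
    (univ.filter (· < j)).image (fun i => m (x i)) ∪ hit H m)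
    (univ.filter (fun v => H.Adj (x (j - 1)) (m v)))
  have h6 := card_union_le ((univ.filter (· < j)).image x ∪
    (univ.filter (· < j)).image (fun i => m (x i))) (hit H m)
  have h7 := card_union_le ((univ.filter (· < j)).image x)
    ((univ.filter (· < j)).image (fun i => m (x i)))
  omega

lemma forbidden_congr {H : SimpleGraph V} {m : Equiv.Perm V} {s : ℕ} {x y : Fin (s + 2) → V}
    {j : Fin (s + 2)} (hj : j ≠ 0) (h : ∀ i < j, x i = y i) :
    forbidden H m x j = forbidden H m y j := by
  have h1 : (univ.filter (· < j)).image x = (univ.filter (· < j)).image y :=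
    image_congr fun i hi => h i (by simpa using hi)
  have h2 : (univ.filter (· < j)).image (fun i => m (x i)) =
      (univ.filter (· < j)).image (fun i => m (y i)) :=
    image_congr fun i hi => by rw [h i (by simpa using hi)]
  have h3 : x (j - 1) = y (j - 1) := h _ (Fin.sub_one_lt_iff.2 (Fin.pos_iff_ne_zero.2 hj))
  have h4 : x 0 = y 0 := h _ (Fin.pos_iff_ne_zero.2 hj)
  unfold forbidden
  rw [h1, h2, h3, h4]

/-- Closed walks with prescribed values on `F` that are bad at position `j`. -/
lemma card_bad_le {G H : SimpleGraph V} {d r : ℕ} (hd : ∀ v, #{u | G.Adj v u} = d)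
    (hr : ∀ v, #{u | H.Adj v u} ≤ r) (m : Equiv.Perm V) {s : ℕ} (F : Finset (Fin (s + 2)))
    (h0 : 0 ∈ F) (w : Fin (s + 2) → V) {j : Fin (s + 2)} (hj : j ∉ F) :
    #{x : Fin (s + 2) → V | (∀ i ∈ F, x i = w i) ∧ IsClosedWalk G m x ∧ x j ∈ forbidden H m x j} ≤
      (2 * (s + 2) + #(hit H m) + 2 * r) * d ^ (s + 1 - #F) := by
  have hne : ∀ i, i ∉ F → i ≠ 0 := fun i hi h => hi (h ▸ h0)
  refine (card_le_prod_choices _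
    (fun i x => if i ∈ F then {w i} else if i = j then forbidden H m x j else
      univ.filter fun v => G.Adj (x (i - 1)) (m v))
    (fun i => if i ∈ F then 1 else if i = j then 2 * (s + 2) + #(hit H m) + 2 * r else d)
    ?_ ?_ ?_).trans (le_of_eq ?_)
  · intro x hx i
    simp only [mem_filter, mem_univ, true_and] at hx
    obtain ⟨h1, h2, h3⟩ := hx
    split_ifs with hi hij
    · simp [h1 i hi]
    · rw [hij]; exact h3
    · have := h2 (i - 1)
      rw [sub_add_cancel] at this
      simpa using this
  · intro i x y hxy
    split_ifs with hi hij
    · rfl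
    · subst hij
      exact forbidden_congr (hne i hi) hxy
    · rw [hxy (i - 1) (Fin.sub_one_lt_iff.2 (Fin.pos_iff_ne_zero.2 (hne i hi)))]
  · intro x hx i
    split_ifs with hi hij
    · simp
    · exact card_forbidden_le hr m x j
    · rw [← hd (x (i - 1))]
      refine card_le_card_of_injOn m ?_ m.injective.injOn
      intro v hv
      simpa using hv
  · have hjF : j ∈ univ \ F := by simp [hj]
    rw [← prod_sdiff (subset_univ F), prod_congr rfl (g := fun _ => 1) (s₁ := F)
      (fun i hi => if_pos hi), prod_const_one, mul_one, ← mul_prod_erase _ _ hjF, if_neg hj,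
      if_pos rfl]
    congr 1
    rw [prod_congr rfl (g := fun _ => d), prod_const, card_erase_of_mem hjF,
      card_sdiff_of_subset (subset_univ F), card_univ, Fintype.card_fin]
    · congr 1
      omega
    · intro i hi
      simp only [mem_erase, mem_sdiff, mem_univ, true_and] at hi
      rw [if_neg hi.2, if_neg hi.1]

/-- Lower bound for the number of closed walks avoiding all forbidden coincidences. -/
lemma card_good_ge {G H : SimpleGraph V} {d r : ℕ} (hd : ∀ v, #{u | G.Adj v u} = d)
    (hr : ∀ v, #{u | H.Adj v u} ≤ r) (m : Equiv.Perm V) {s : ℕ} (F : Finset (Fin (s + 2)))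
    (h0 : 0 ∈ F) (w : Fin (s + 2) → V) :
    #{x : Fin (s + 2) → V | (∀ i ∈ F, x i = w i) ∧ IsClosedWalk G m x} ≤
      #{x : Fin (s + 2) → V | (∀ i ∈ F, x i = w i) ∧ IsClosedWalk G m x ∧
        ∀ j, j ∉ F → x j ∉ forbidden H m x j} +
      (s + 2) * ((2 * (s + 2) + #(hit H m) + 2 * r) * d ^ (s + 1 - #F)) := by
  have hsub : ({x : Fin (s + 2) → V | (∀ i ∈ F, x i = w i) ∧ IsClosedWalk G m x} : Finset _) ⊆
      ({x : Fin (s + 2) → V | (∀ i ∈ F, x i = w i) ∧ IsClosedWalk G m x ∧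
        ∀ j, j ∉ F → x j ∉ forbidden H m x j} : Finset _) ∪
      (univ \ F).biUnion fun j => ({x : Fin (s + 2) → V | (∀ i ∈ F, x i = w i) ∧
        IsClosedWalk G m x ∧ x j ∈ forbidden H m x j} : Finset _) := by
    intro x hx
    simp only [mem_filter, mem_univ, true_and, mem_union, mem_biUnion, mem_sdiff] at hx ⊢
    by_cases h : ∀ j, j ∉ F → x j ∉ forbidden H m x j
    · exact Or.inl ⟨hx.1, hx.2, h⟩
    · push Not at h
      obtain ⟨j, hj, hxj⟩ := h
      exact Or.inr ⟨j, hj, hx.1, hx.2, hxj⟩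
  refine (card_le_card hsub).trans ((card_union_le _ _).trans (Nat.add_le_add_left ?_ _))
  refine (card_biUnion_le_card_mul _ _ _ fun j hj =>
    card_bad_le hd hr m F h0 w (by simpa using hj)).trans (Nat.mul_le_mul_right _ ?_)
  simpa using card_le_univ (univ \ F)

/-- The permutation rotating the entries of an injective sequence. -/
noncomputable def cyclePerm {s : ℕ} (x : Fin (s + 2) → V) : Equiv.Perm V :=
  if hx : Function.Injective x then
    Equiv.Perm.viaFintypeEmbedding (Equiv.addRight (1 : Fin (s + 2))) ⟨x, hx⟩
  else 1

lemma cyclePerm_apply {s : ℕ} {x : Fin (s + 2) → V} (hx : Function.Injective x) (i : Fin (s + 2)) :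
    cyclePerm x (x i) = x (i + 1) := by
  rw [cyclePerm, dif_pos hx]
  exact Equiv.Perm.viaFintypeEmbedding_apply_image (Equiv.addRight (1 : Fin (s + 2))) ⟨x, hx⟩ i

lemma cyclePerm_apply_of_notMem {s : ℕ} {x : Fin (s + 2) → V} {v : V} (hv : ∀ i, v ≠ x i) :
    cyclePerm x v = v := by
  unfold cyclePerm
  split_ifs with hx
  · refine Equiv.Perm.viaFintypeEmbedding_apply_notMem_range _ _ ?_
    rintro ⟨i, hi⟩
    exact hv i hi.symm
  · rfl

lemma cyclePerm_symm_apply_of_notMem {s : ℕ} {x : Fin (s + 2) → V} {v : V} (hv : ∀ i, v ≠ x i) :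
    (cyclePerm x)⁻¹ v = v := by
  rw [Equiv.Perm.inv_eq_iff_eq, cyclePerm_apply_of_notMem hv]

/-- Switching the matching `m` along the alternating cycle given by `x`. -/
noncomputable def switch (m : Equiv.Perm V) {s : ℕ} (x : Fin (s + 2) → V) : Equiv.Perm V :=
  (cyclePerm x)⁻¹ * m * cyclePerm x

/-- The alternating closed walk given by `x` does not meet itself. -/
def IsSimple (m : Equiv.Perm V) {s : ℕ} (x : Fin (s + 2) → V) : Prop :=
  Function.Injective x ∧ ∀ i j, x i ≠ m (x j)

lemma switch_apply {m : Equiv.Perm V} {s : ℕ} {x : Fin (s + 2) → V} (h : IsSimple m x)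
    (i : Fin (s + 2)) : switch m x (x i) = m (x (i + 1)) := by
  rw [switch, Equiv.Perm.mul_apply, Equiv.Perm.mul_apply, cyclePerm_apply h.1]
  exact cyclePerm_symm_apply_of_notMem fun j hj => h.2 j (i + 1) hj.symm

lemma switch_switch {m : Equiv.Perm V} (hm : ∀ v, m (m v) = v) {s : ℕ} (x : Fin (s + 2) → V)
    (v : V) : switch m x (switch m x v) = v := by
  simp [switch, Equiv.Perm.mul_apply, hm]

lemma switch_apply_partner {m : Equiv.Perm V} (hm : ∀ v, m (m v) = v) {s : ℕ}
    {x : Fin (s + 2) → V} (h : IsSimple m x) (i : Fin (s + 2)) :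
    switch m x (m (x (i + 1))) = x i := by
  rw [← switch_apply h, switch_switch hm]

lemma switch_apply_of_notMem {m : Equiv.Perm V} (hm : ∀ v, m (m v) = v) {s : ℕ}
    {x : Fin (s + 2) → V} {v : V} (hv : ∀ i, v ≠ x i) (hv' : ∀ i, v ≠ m (x i)) :
    switch m x v = m v := by
  rw [switch, Equiv.Perm.mul_apply, Equiv.Perm.mul_apply, cyclePerm_apply_of_notMem hv]
  exact cyclePerm_symm_apply_of_notMem fun j hj => hv' j (by rw [← hj, hm])

lemma switch_mem_pmPerms {G : SimpleGraph V} {m : Equiv.Perm V} (hm : m ∈ pmPerms G) {s : ℕ}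
    {x : Fin (s + 2) → V} (h : IsSimple m x) (hx : IsClosedWalk G m x) :
    switch m x ∈ pmPerms G := by
  obtain ⟨hm1, hm2⟩ := mem_pmPerms.1 hm
  refine mem_pmPerms.2 ⟨switch_switch hm1 x, fun v => ?_⟩
  by_cases h1 : ∃ i, v = x i
  · obtain ⟨i, rfl⟩ := h1
    rw [switch_apply h]; exact hx i
  by_cases h2 : ∃ i, v = m (x i)
  · obtain ⟨i, rfl⟩ := h2
    obtain ⟨j, rfl⟩ : ∃ j, i = j + 1 := ⟨i - 1, by simp⟩
    rw [switch_apply_partner hm1 h]; exact (hx j).symm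
  · push Not at h1 h2
    rw [switch_apply_of_notMem hm1 h1 h2]; exact hm2 v

lemma isClosedWalk_switch {G : SimpleGraph V} {m : Equiv.Perm V} (hm : m ∈ pmPerms G) {s : ℕ}
    {x : Fin (s + 2) → V} (h : IsSimple m x) :
    IsClosedWalk G (switch m x) (fun i => x (-i)) := by
  intro i
  dsimp only
  rw [switch_apply h, show -(i + 1) + 1 = -i by abel]
  exact (mem_pmPerms.1 hm).2 _

/-- Switching, together with reversing the walk, is injective. -/
lemma switch_injOn {m m' : Equiv.Perm V} {s : ℕ} {x x' : Fin (s + 2) → V}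
    (h : switch m x = switch m' x') (hx : (fun i => x (-i)) = fun i => x' (-i)) :
    m = m' ∧ x = x' := by
  have hxx : x = x' := by
    ext i
    simpa using congrFun hx (-i)
  subst hxx
  refine ⟨?_, rfl⟩
  simpa [switch] using h

/-- Membership in the hit set after a switch. -/
lemma mem_hit_switch {H : SimpleGraph V} {m : Equiv.Perm V} (hm : ∀ v, m (m v) = v) {s : ℕ}
    {x : Fin (s + 2) → V} (h : IsSimple m x) (v : V) :
    v ∈ hit H (switch m x) ↔
      (∃ i, (v = x i ∨ v = m (x (i + 1))) ∧ H.Adj (x i) (m (x (i + 1)))) ∨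
      ((∀ i, v ≠ x i ∧ v ≠ m (x i)) ∧ v ∈ hit H m) := by
  rw [mem_hit]
  by_cases h1 : ∃ i, v = x i
  · obtain ⟨i, rfl⟩ := h1
    rw [switch_apply h]
    constructor
    · intro hi; exact Or.inl ⟨i, Or.inl rfl, hi⟩
    · rintro (⟨j, hj | hj, hj'⟩ | ⟨hi, -⟩)
      · rwa [h.1 hj]
      · exact absurd hj (h.2 _ _)
      · exact absurd rfl (hi i).1
  by_cases h2 : ∃ i, v = m (x i)
  · obtain ⟨i, rfl⟩ := h2
    obtain ⟨j, rfl⟩ : ∃ j, i = j + 1 := ⟨i - 1, by simp⟩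
    rw [switch_apply_partner hm h]
    constructor
    · intro hi; exact Or.inl ⟨j, Or.inr rfl, hi.symm⟩
    · rintro (⟨k, hk | hk, hk'⟩ | ⟨hi, -⟩)
      · exact absurd hk.symm (h.2 _ _)
      · have := add_right_cancel (h.1 (m.injective hk))
        subst this
        exact hk'.symm
      · exact absurd rfl (hi _).2
  · push Not at h1 h2
    rw [switch_apply_of_notMem hm h1 h2, ← mem_hit]
    constructor
    · intro hi; exact Or.inr ⟨fun i => ⟨h1 i, h2 i⟩, hi⟩
    · rintro (⟨j, hj | hj, hj'⟩ | ⟨-, hi⟩)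
      · exact absurd hj (h1 _)
      · exact absurd hj (h2 _)
      · exact hi

lemma card_hit_of_forward {H : SimpleGraph V} {m : Equiv.Perm V} (hm : ∀ v, m (m v) = v) {s : ℕ}
    {x : Fin (s + 2) → V} (h : IsSimple m x) (h0 : x 0 ∈ hit H m)
    (h1 : ∀ i, i ≠ 0 → x i ∉ hit H m) (h2 : ∀ i, ¬ H.Adj (x i) (m (x (i + 1)))) :
    #(hit H m) = #(hit H (switch m x)) + 2 := by
  have heq : hit H m = hit H (switch m x) ∪ {x 0, m (x 0)} := by
    ext v
    rw [mem_union, mem_hit_switch hm h, mem_insert, mem_singleton]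
    constructor
    · intro hv
      by_cases hv0 : v = x 0 ∨ v = m (x 0)
      · exact Or.inr hv0
      · refine Or.inl (Or.inr ⟨fun i => ⟨?_, ?_⟩, hv⟩)
        · rintro rfl
          by_cases hi : i = 0
          · subst hi; exact hv0 (Or.inl rfl)
          · exact h1 i hi hv
        · rintro rfl
          by_cases hi : i = 0
          · subst hi; exact hv0 (Or.inr rfl)
          · exact h1 i hi ((apply_mem_hit hm).1 hv)
    · rintro ((⟨i, -, hi⟩ | ⟨-, hv⟩) | rfl | rfl)
      · exact absurd hi (h2 i)
      · exact hv
      · exact h0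
      · exact (apply_mem_hit hm).2 h0
  have hdisj : Disjoint (hit H (switch m x)) {x 0, m (x 0)} := by
    rw [disjoint_left]
    intro v hv hv'
    rw [mem_hit_switch hm h] at hv
    rw [mem_insert, mem_singleton] at hv'
    rcases hv with ⟨i, -, hi⟩ | ⟨hi, -⟩
    · exact h2 i hi
    · rcases hv' with hv' | hv'
      · exact (hi 0).1 hv'
      · exact (hi 0).2 hv'
  conv_lhs => rw [heq]
  rw [card_union_of_disjoint hdisj, card_pair (h.2 0 0)]

lemma card_hit_of_backward {H : SimpleGraph V} {m : Equiv.Perm V} (hm : ∀ v, m (m v) = v) {s : ℕ}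
    {x : Fin (s + 2) → V} (h : IsSimple m x) (h0 : H.Adj (x 0) (m (x 1)))
    (h1 : ∀ i, x i ∉ hit H m) (h2 : ∀ i, i ≠ 0 → ¬ H.Adj (x i) (m (x (i + 1)))) :
    #(hit H (switch m x)) = #(hit H m) + 2 := by
  have heq : hit H (switch m x) = hit H m ∪ {x 0, m (x 1)} := by
    ext v
    rw [mem_union, mem_hit_switch hm h, mem_insert, mem_singleton]
    constructor
    · rintro (⟨i, hv, hi⟩ | ⟨-, hv⟩)
      · by_cases hi0 : i = 0
        · subst hi0; rw [zero_add] at hv; exact Or.inr hv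
        · exact absurd hi (h2 i hi0)
      · exact Or.inl hv
    · rintro (hv | hv)
      · refine Or.inr ⟨fun i => ⟨?_, ?_⟩, hv⟩
        · rintro rfl; exact h1 i hv
        · rintro rfl; exact h1 i ((apply_mem_hit hm).1 hv)
      · exact Or.inl ⟨0, by rw [zero_add]; exact hv, by rw [zero_add]; exact h0⟩
  have hdisj : Disjoint (hit H m) {x 0, m (x 1)} := by
    rw [disjoint_right]
    intro v hv hv'
    rw [mem_insert, mem_singleton] at hv
    rcases hv with rfl | rfl
    · exact h1 0 hv'
    · exact h1 1 ((apply_mem_hit hm).1 hv')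
  rw [heq, card_union_of_disjoint hdisj, card_pair (h.2 0 1)]

end Switching

section Levels
open scoped Classical

variable {V : Type*} [Fintype V] [DecidableEq V]

lemma notMem_forbidden {H : SimpleGraph V} {m : Equiv.Perm V} {s : ℕ} {x : Fin (s + 2) → V}
    {j : Fin (s + 2)} (h : x j ∉ forbidden H m x j) :
    (∀ i < j, x j ≠ x i ∧ x j ≠ m (x i)) ∧ x j ∉ hit H m ∧ ¬ H.Adj (x (j - 1)) (m (x j)) ∧
      ¬ H.Adj (x j) (m (x 0)) := by
  simp only [forbidden, mem_union, mem_image, mem_filter, mem_univ, true_and, not_or, not_exists,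
    not_and] at h
  obtain ⟨⟨⟨⟨h1, h2⟩, h3⟩, h4⟩, h5⟩ := h
  exact ⟨fun i hi => ⟨fun h => h1 i hi h.symm, fun h => h2 i hi h.symm⟩, h3, h4, h5⟩

lemma isSimple_of_lt {G : SimpleGraph V} {m : Equiv.Perm V} (hm : m ∈ pmPerms G) {s : ℕ}
    {x : Fin (s + 2) → V} (h : ∀ i j, i < j → x j ≠ x i ∧ x j ≠ m (x i)) : IsSimple m x := by
  obtain ⟨hm1, hm2⟩ := mem_pmPerms.1 hm
  constructor
  · intro i j hij
    by_contra hne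
    rcases lt_or_gt_of_ne hne with hlt | hlt
    · exact (h i j hlt).1 hij.symm
    · exact (h j i hlt).1 hij
  · intro i j hij
    rcases lt_trichotomy i j with hlt | rfl | hlt
    · exact (h i j hlt).2 (by rw [hij, hm1])
    · exact (hm2 (x i)).ne hij
    · exact (h j i hlt).2 hij

/-- Closed walks starting at a vertex hit by `H`. -/
noncomputable def forwardWalks (G H : SimpleGraph V) (m : Equiv.Perm V) (s : ℕ) :
    Finset (Fin (s + 2) → V) :=
  {x | x 0 ∈ hit H m ∧ IsClosedWalk G m x}

/-- The members of `forwardWalks` without forbidden coincidences. -/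
noncomputable def forwardGood (G H : SimpleGraph V) (m : Equiv.Perm V) (s : ℕ) :
    Finset (Fin (s + 2) → V) :=
  {x | x 0 ∈ hit H m ∧ IsClosedWalk G m x ∧
    ∀ j, j ∉ ({0} : Finset (Fin (s + 2))) → x j ∉ forbidden H m x j}

/-- Closed walks whose first step is along an edge of `H`. -/
noncomputable def backwardWalks (G H : SimpleGraph V) (m : Equiv.Perm V) (s : ℕ) :
    Finset (Fin (s + 2) → V) :=
  {x | H.Adj (x 0) (m (x 1)) ∧ IsClosedWalk G m x}

/-- The members of `backwardWalks` without forbidden coincidences. -/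
noncomputable def backwardGood (G H : SimpleGraph V) (m : Equiv.Perm V) (s : ℕ) :
    Finset (Fin (s + 2) → V) :=
  {x | (H.Adj (x 0) (m (x 1)) ∧ x 0 ∉ hit H m ∧ m (x 1) ∉ hit H m) ∧ IsClosedWalk G m x ∧
    ∀ j, j ∉ ({0, 1} : Finset (Fin (s + 2))) → x j ∉ forbidden H m x j}

/-- Ordered adjacent pairs of `H`. -/
noncomputable def adjPairs (H : SimpleGraph V) : Finset (V × V) := {p | H.Adj p.1 p.2}

/-- Matchings with exactly `k` edges in `H`. -/
noncomputable def level (G H : SimpleGraph V) (k : ℕ) : Finset (Equiv.Perm V) :=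
  {m ∈ pmPerms G | #(hit H m) = 2 * k}

lemma switch_of_forwardGood {G H : SimpleGraph V} {m : Equiv.Perm V} (hm : m ∈ pmPerms G) {s : ℕ}
    {x : Fin (s + 2) → V} (hx : x ∈ forwardGood G H m s) :
    switch m x ∈ pmPerms G ∧ #(hit H m) = #(hit H (switch m x)) + 2 ∧
      (fun i => x (-i)) ∈ backwardWalks G H (switch m x) s := by
  obtain ⟨hm1, hm2⟩ := mem_pmPerms.1 hm
  simp only [forwardGood, mem_filter, mem_univ, true_and, mem_singleton] at hx
  obtain ⟨h0, hw, hg⟩ := hx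
  have hgood := fun j hj => notMem_forbidden (hg j hj)
  have hsimple : IsSimple m x := isSimple_of_lt hm fun i j hij =>
    (hgood j (by rintro rfl; exact Fin.not_lt_zero i hij)).1 i hij
  have h2 : ∀ i, ¬ H.Adj (x i) (m (x (i + 1))) := by
    intro i
    by_cases hi : i + 1 = 0
    · rw [hi]
      refine (hgood i ?_).2.2.2
      rintro rfl
      simp at hi
    · have := (hgood (i + 1) hi).2.2.1
      rwa [add_sub_cancel_right] at this
  refine ⟨switch_mem_pmPerms hm hsimple hw,
    card_hit_of_forward hm1 hsimple h0 (fun i hi => (hgood i hi).2.1) h2, ?_⟩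
  simp only [backwardWalks, mem_filter, mem_univ, true_and]
  refine ⟨?_, isClosedWalk_switch hm hsimple⟩
  rw [switch_apply hsimple, neg_zero, neg_add_cancel]
  exact mem_hit.1 h0

lemma switch_of_backwardGood {G H : SimpleGraph V} {m : Equiv.Perm V} (hm : m ∈ pmPerms G) {s : ℕ}
    (hs : 1 ≤ s) {x : Fin (s + 2) → V} (hx : x ∈ backwardGood G H m s) :
    switch m x ∈ pmPerms G ∧ #(hit H (switch m x)) = #(hit H m) + 2 ∧
      (fun i => x (-i)) ∈ forwardWalks G H (switch m x) s := by
  obtain ⟨hm1, hm2⟩ := mem_pmPerms.1 hm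
  simp only [backwardGood, mem_filter, mem_univ, true_and, mem_insert, mem_singleton, not_or,
    and_imp] at hx
  obtain ⟨⟨h0, h00, h01⟩, hw, hg⟩ := hx
  rw [apply_mem_hit hm1] at h01
  have hgood := fun j hj hj' => notMem_forbidden (hg j hj hj')
  have hsimple : IsSimple m x := isSimple_of_lt hm fun i j hij => by
    by_cases hj : j = 1
    · subst hj
      have hi : i = 0 := by
        rw [Fin.lt_def] at hij
        ext
        simp at hij ⊢
        omega
      subst hi
      constructor
      · intro h
        rw [h] at h0
        exact h00 (mem_hit.2 h0)
      · intro h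
        rw [h, hm1] at h0
        exact H.irrefl h0
    · exact (hgood j (by rintro rfl; exact Fin.not_lt_zero i hij) hj).1 i hij
  have h1 : ∀ i, x i ∉ hit H m := by
    intro i
    by_cases hi : i = 0
    · rwa [hi]
    by_cases hi' : i = 1
    · rwa [hi']
    exact (hgood i hi hi').2.1
  have h2 : ∀ i, i ≠ 0 → ¬ H.Adj (x i) (m (x (i + 1))) := by
    intro i hi0
    by_cases hi : i + 1 = 0
    · rw [hi]
      refine (hgood i hi0 ?_).2.2.2
      rintro rfl
      have := congrArg Fin.val hi
      rw [Fin.val_add] at this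
      simp at this
      rw [Nat.mod_eq_of_lt (by omega)] at this
      omega
    · have := (hgood (i + 1) hi (by simpa using hi0)).2.2.1
      rwa [add_sub_cancel_right] at this
  refine ⟨switch_mem_pmPerms hm hsimple hw,
    card_hit_of_backward hm1 hsimple h0 h1 h2, ?_⟩
  simp only [forwardWalks, mem_filter, mem_univ, true_and]
  refine ⟨?_, isClosedWalk_switch hm hsimple⟩
  rw [mem_hit, switch_apply hsimple, neg_zero, zero_add]
  exact h0

/-- Switching injects the good forward walks over one level into the backward walks over the
level below. -/
lemma sum_forwardGood_le (G H : SimpleGraph V) (s k : ℕ) :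
    ∑ m ∈ level G H (k + 1), #(forwardGood G H m s) ≤
      ∑ m ∈ level G H k, #(backwardWalks G H m s) := by
  rw [← card_sigma, ← card_sigma]
  refine card_le_card_of_injOn (fun p => ⟨switch p.1 p.2, fun i => p.2 (-i)⟩) ?_ ?_
  · rintro ⟨m, x⟩ hp
    simp only [coe_sigma, Set.mem_sigma_iff, mem_coe, level, mem_filter] at hp ⊢
    obtain ⟨⟨hm, hk⟩, hx⟩ := hp
    obtain ⟨h1, h2, h3⟩ := switch_of_forwardGood hm hx
    exact ⟨⟨h1, by omega⟩, h3⟩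
  · rintro ⟨m, x⟩ - ⟨m', x'⟩ - h
    simp only [Sigma.mk.injEq, heq_eq_eq] at h
    obtain ⟨rfl, rfl⟩ := switch_injOn h.1 h.2
    rfl

/-- Switching injects the good backward walks over one level into the forward walks over the
level above. -/
lemma sum_backwardGood_le (G H : SimpleGraph V) {s : ℕ} (hs : 1 ≤ s) (k : ℕ) :
    ∑ m ∈ level G H k, #(backwardGood G H m s) ≤
      ∑ m ∈ level G H (k + 1), #(forwardWalks G H m s) := by
  rw [← card_sigma, ← card_sigma]
  refine card_le_card_of_injOn (fun p => ⟨switch p.1 p.2, fun i => p.2 (-i)⟩) ?_ ?_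
  · rintro ⟨m, x⟩ hp
    simp only [coe_sigma, Set.mem_sigma_iff, mem_coe, level, mem_filter] at hp ⊢
    obtain ⟨⟨hm, hk⟩, hx⟩ := hp
    obtain ⟨h1, h2, h3⟩ := switch_of_backwardGood hm hs hx
    exact ⟨⟨h1, by omega⟩, h3⟩
  · rintro ⟨m, x⟩ - ⟨m', x'⟩ - h
    simp only [Sigma.mk.injEq, heq_eq_eq] at h
    obtain ⟨rfl, rfl⟩ := switch_injOn h.1 h.2
    rfl

lemma card_closedWalks_one (G : SimpleGraph V) (m : Equiv.Perm V) (s : ℕ) (a : V) :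
    (#{x : Fin (s + 2) → V | (∀ i ∈ ({0} : Finset (Fin (s + 2))), x i = a) ∧
      IsClosedWalk G m x} : ℝ) = (walkMatrix G m ^ (s + 2)) a a := by
  rw [← card_closed_paths (R := fun x y => G.Adj x (m y)) (walkMatrix_apply G m) (s + 1) a]
  simp [IsClosedWalk]

lemma card_closedWalks_two (G : SimpleGraph V) (m : Equiv.Perm V) (s : ℕ) {a b : V}
    (hab : G.Adj a (m b)) :
    (#{x : Fin (s + 2) → V | (∀ i ∈ ({0, 1} : Finset (Fin (s + 2))),
      x i = if i = 0 then a else b) ∧ IsClosedWalk G m x} : ℝ) =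
      (walkMatrix G m ^ (s + 1)) b a := by
  rw [← card_closed_paths_two (R := fun x y => G.Adj x (m y)) (walkMatrix_apply G m) s hab]
  simp [IsClosedWalk, and_assoc]

section Bounds

variable {G H : SimpleGraph V} {d r : ℕ} {m : Equiv.Perm V} {s : ℕ} {e : ℝ}

lemma card_forwardWalks_le
    (hmix : ∀ x y, |(walkMatrix G m ^ (s + 2)) x y - (d : ℝ) ^ (s + 2) / Fintype.card V| ≤
      (d : ℝ) ^ (s + 2) * e) :
    (#(forwardWalks G H m s) : ℝ) ≤
      #(hit H m) * ((d : ℝ) ^ (s + 2) * (1 / Fintype.card V + e)) := by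
  rw [card_eq_sum_card_fiberwise (f := fun x => x 0) (t := hit H m)
    (fun x hx => by simp only [forwardWalks, mem_coe, mem_filter] at hx ⊢; exact hx.2.1)]
  rw [Nat.cast_sum, ← nsmul_eq_mul]
  refine sum_le_card_nsmul _ _ _ fun a ha => ?_
  have h1 := (abs_le.1 (hmix a a)).2
  rw [← card_closedWalks_one] at h1
  refine le_trans ?_ ((sub_le_iff_le_add.1 h1).trans (le_of_eq (by ring)))
  norm_cast
  refine card_le_card fun x hx => ?_
  simp only [forwardWalks, mem_filter, mem_univ, true_and, mem_singleton, forall_eq] at hx ⊢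
  exact ⟨hx.2, hx.1.2⟩

lemma card_forwardGood_ge (hd : ∀ v, #{u | G.Adj v u} = d) (hr : ∀ v, #{u | H.Adj v u} ≤ r)
    (hmix : ∀ x y, |(walkMatrix G m ^ (s + 2)) x y - (d : ℝ) ^ (s + 2) / Fintype.card V| ≤
      (d : ℝ) ^ (s + 2) * e) :
    #(hit H m) * ((d : ℝ) ^ (s + 2) * (1 / Fintype.card V - e) -
      (s + 2) * ((2 * (s + 2) + #(hit H m) + 2 * r) * (d : ℝ) ^ s)) ≤
      #(forwardGood G H m s) := by
  rw [card_eq_sum_card_fiberwise (f := fun x => x 0) (t := hit H m) (s := forwardGood G H m s)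
    (fun x hx => by simp only [forwardGood, mem_coe, mem_filter] at hx ⊢; exact hx.2.1)]
  rw [Nat.cast_sum, ← nsmul_eq_mul]
  refine card_nsmul_le_sum _ _ _ fun a ha => ?_
  have h1 := (abs_le.1 (hmix a a)).1
  rw [← card_closedWalks_one] at h1
  have h2 := card_good_ge hd hr m ({0} : Finset (Fin (s + 2))) (by simp) (fun _ => a)
  rw [card_singleton, Nat.add_sub_cancel] at h2
  have h3 : #{x : Fin (s + 2) → V | (∀ i ∈ ({0} : Finset (Fin (s + 2))), x i = a) ∧
      IsClosedWalk G m x ∧ ∀ j, j ∉ ({0} : Finset (Fin (s + 2))) → x j ∉ forbidden H m x j} ≤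
      #{x ∈ forwardGood G H m s | x 0 = a} := by
    refine card_le_card fun x hx => ?_
    simp only [forwardGood, mem_filter, mem_univ, true_and, mem_singleton, forall_eq] at hx ⊢
    exact ⟨⟨by rw [hx.1]; exact ha, hx.2⟩, hx.1⟩
  have h4 := h2.trans (Nat.add_le_add_right h3 _)
  have h5 := (Nat.cast_le (α := ℝ)).2 h4
  push_cast at h5
  refine le_trans (b := (#{x ∈ forwardGood G H m s | x 0 = a} : ℝ)) ?_ (le_of_eq (by congr!))
  rw [mul_sub, mul_one_div]
  linarith

lemma card_backwardWalks_le (hHG : H ≤ G) (hm : m ∈ pmPerms G)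
    (hmix : ∀ x y, |(walkMatrix G m ^ (s + 1)) x y - (d : ℝ) ^ (s + 1) / Fintype.card V| ≤
      (d : ℝ) ^ (s + 1) * e) :
    (#(backwardWalks G H m s) : ℝ) ≤
      #(adjPairs H) * ((d : ℝ) ^ (s + 1) * (1 / Fintype.card V + e)) := by
  have hm1 := (mem_pmPerms.1 hm).1
  rw [card_eq_sum_card_fiberwise (f := fun x => (x 0, m (x 1))) (t := adjPairs H)
    (fun x hx => by
      simp only [backwardWalks, adjPairs, mem_coe, mem_filter, mem_univ, true_and] at hx ⊢
      exact hx.1)]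
  rw [Nat.cast_sum, ← nsmul_eq_mul]
  refine sum_le_card_nsmul _ _ _ fun p hp => ?_
  obtain ⟨a, b⟩ := p
  simp only [adjPairs, mem_filter, mem_univ, true_and] at hp
  have h1 := (abs_le.1 (hmix (m b) a)).2
  rw [← card_closedWalks_two G m s (by rw [hm1]; exact hHG hp)] at h1
  refine le_trans ?_ ((sub_le_iff_le_add.1 h1).trans (le_of_eq (by ring)))
  norm_cast
  refine card_le_card fun x hx => ?_
  simp only [backwardWalks, mem_filter, mem_univ, true_and, mem_insert, mem_singleton,
    Prod.mk.injEq] at hx ⊢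
  refine ⟨?_, hx.1.2⟩
  rintro i (rfl | rfl)
  · simp [hx.2.1]
  · simp [← hx.2.2, hm1]

lemma card_adjPairs_good (hr : ∀ v, #{u | H.Adj v u} ≤ r) :
    #(adjPairs H) ≤ #{p ∈ adjPairs H | p.1 ∉ hit H m ∧ p.2 ∉ hit H m} + 2 * (#(hit H m) * r) := by
  have hsub : adjPairs H ⊆ {p ∈ adjPairs H | p.1 ∉ hit H m ∧ p.2 ∉ hit H m} ∪
      ({p ∈ adjPairs H | p.1 ∈ hit H m} ∪ {p ∈ adjPairs H | p.2 ∈ hit H m}) := by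
    intro p hp
    simp only [mem_union, mem_filter]
    tauto
  have h1 : #{p ∈ adjPairs H | p.1 ∈ hit H m} ≤ #(hit H m) * r := by
    rw [mul_comm]
    refine card_le_mul_card_image_of_maps_to (f := Prod.fst) (fun p hp => (mem_filter.1 hp).2) r ?_
    intro a ha
    refine le_trans ?_ (hr a)
    refine card_le_card_of_injOn Prod.snd ?_ ?_
    · rintro ⟨u, v⟩ h
      simp only [adjPairs, mem_coe, mem_filter, mem_univ, true_and] at h ⊢
      rw [← h.2]; exact h.1.1
    · rintro ⟨u, v⟩ h ⟨u', v'⟩ h' hv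
      simp only [mem_coe, mem_filter] at h h'
      simp_all
  have h2 : #{p ∈ adjPairs H | p.2 ∈ hit H m} ≤ #{p ∈ adjPairs H | p.1 ∈ hit H m} := by
    refine card_le_card_of_injOn Prod.swap ?_ Prod.swap_injective.injOn
    rintro ⟨u, v⟩ h
    simp only [adjPairs, mem_coe, mem_filter, mem_univ, true_and, Prod.swap] at h ⊢
    exact ⟨h.1.symm, h.2⟩
  have h3 := (card_le_card hsub).trans (card_union_le _ _)
  have h4 := card_union_le ({p ∈ adjPairs H | p.1 ∈ hit H m}) ({p ∈ adjPairs H | p.2 ∈ hit H m})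
  omega

lemma card_backwardGood_ge (hs : 1 ≤ s) (hHG : H ≤ G) (hm : m ∈ pmPerms G)
    (hd : ∀ v, #{u | G.Adj v u} = d) (hr : ∀ v, #{u | H.Adj v u} ≤ r)
    (hmix : ∀ x y, |(walkMatrix G m ^ (s + 1)) x y - (d : ℝ) ^ (s + 1) / Fintype.card V| ≤
      (d : ℝ) ^ (s + 1) * e)
    (hpos : 0 ≤ (d : ℝ) ^ (s + 1) * (1 / Fintype.card V - e) -
      (s + 2) * ((2 * (s + 2) + #(hit H m) + 2 * r) * (d : ℝ) ^ (s - 1))) :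
    (#(adjPairs H) - 2 * (#(hit H m) * r)) * ((d : ℝ) ^ (s + 1) * (1 / Fintype.card V - e) -
      (s + 2) * ((2 * (s + 2) + #(hit H m) + 2 * r) * (d : ℝ) ^ (s - 1))) ≤
      #(backwardGood G H m s) := by
  have hm1 := (mem_pmPerms.1 hm).1
  have hcard := (Nat.cast_le (α := ℝ)).2 (card_adjPairs_good (H := H) (m := m) hr)
  push_cast at hcard
  refine (mul_le_mul_of_nonneg_right (sub_le_iff_le_add.2 hcard) hpos).trans ?_
  rw [card_eq_sum_card_fiberwise (f := fun x => (x 0, m (x 1)))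
    (t := {p ∈ adjPairs H | p.1 ∉ hit H m ∧ p.2 ∉ hit H m}) (s := backwardGood G H m s)
    (fun x hx => by
      simp only [backwardGood, adjPairs, mem_coe, mem_filter, mem_univ, true_and] at hx ⊢
      exact hx.1)]
  rw [Nat.cast_sum, ← nsmul_eq_mul]
  refine card_nsmul_le_sum _ _ _ fun p hp => ?_
  obtain ⟨a, b⟩ := p
  simp only [adjPairs, mem_filter, mem_univ, true_and] at hp
  have h1 := (abs_le.1 (hmix (m b) a)).1
  rw [← card_closedWalks_two G m s (by rw [hm1]; exact hHG hp.1)] at h1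
  have h2 := card_good_ge hd hr m ({0, 1} : Finset (Fin (s + 2))) (by simp)
    (fun i => if i = 0 then a else m b)
  rw [card_pair (by simp), show s + 1 - 2 = s - 1 by omega] at h2
  have h3 : #{x : Fin (s + 2) → V | (∀ i ∈ ({0, 1} : Finset (Fin (s + 2))),
      x i = if i = 0 then a else m b) ∧ IsClosedWalk G m x ∧
        ∀ j, j ∉ ({0, 1} : Finset (Fin (s + 2))) → x j ∉ forbidden H m x j} ≤
      #{x ∈ backwardGood G H m s | (x 0, m (x 1)) = (a, b)} := by
    refine card_le_card fun x hx => ?_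
    simp only [mem_filter, mem_univ, true_and] at hx
    have hx0 : x 0 = a := by simpa using hx.1 0 (by simp)
    have hx1 : x 1 = m b := by simpa using hx.1 1 (by simp)
    simp only [backwardGood, mem_filter, mem_univ, true_and, hx0, hx1, hm1]
    exact ⟨⟨hp, hx.2⟩, trivial⟩
  have h4 := h2.trans (Nat.add_le_add_right h3 _)
  have h5 := (Nat.cast_le (α := ℝ)).2 h4
  push_cast at h5
  have h6 := h1.trans (sub_le_sub_right (by convert h5) _)
  refine le_trans (b := (#{x ∈ backwardGood G H m s | (x 0, m (x 1)) = (a, b)} : ℝ)) ?_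
    (le_of_eq (by congr!))
  rw [mul_sub, mul_one_div]
  linarith

end Bounds

/-- Upper bound for a level in terms of the level below. -/
lemma level_succ_le {G H : SimpleGraph V} {d r s : ℕ} {e : ℝ} (hHG : H ≤ G)
    (hd : ∀ v, #{u | G.Adj v u} = d) (hr : ∀ v, #{u | H.Adj v u} ≤ r)
    (hmix : ∀ t, s + 1 ≤ t → ∀ m : Equiv.Perm V, ∀ x y,
      |(walkMatrix G m ^ t) x y - (d : ℝ) ^ t / Fintype.card V| ≤ (d : ℝ) ^ t * e) (k : ℕ) :
    (#(level G H (k + 1)) : ℝ) * ((2 * (k + 1)) * ((d : ℝ) ^ (s + 2) * (1 / Fintype.card V - e) -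
      (s + 2) * ((2 * (s + 2) + 2 * (k + 1) + 2 * r) * (d : ℝ) ^ s))) ≤
    #(level G H k) * (#(adjPairs H) * ((d : ℝ) ^ (s + 1) * (1 / Fintype.card V + e))) := by
  have h := (Nat.cast_le (α := ℝ)).2 (sum_forwardGood_le G H s k)
  push_cast at h
  rw [← nsmul_eq_mul, ← nsmul_eq_mul (#(level G H k))]
  refine (card_nsmul_le_sum _ _ _ fun m hm => ?_).trans
    (h.trans (sum_le_card_nsmul _ _ _ fun m hm => ?_))
  · have hm2 := (mem_filter.1 hm).2
    have := card_forwardGood_ge hd hr (hmix (s + 2) (by omega) m)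
    rw [hm2] at this
    push_cast at this
    exact this
  · exact card_backwardWalks_le hHG (mem_filter.1 hm).1 (hmix (s + 1) le_rfl m)

/-- Lower bound for a level in terms of the level below. -/
lemma le_level_succ {G H : SimpleGraph V} {d r s : ℕ} {e : ℝ} (hs : 1 ≤ s) (hHG : H ≤ G)
    (hd : ∀ v, #{u | G.Adj v u} = d) (hr : ∀ v, #{u | H.Adj v u} ≤ r)
    (hmix : ∀ t, s + 1 ≤ t → ∀ m : Equiv.Perm V, ∀ x y,
      |(walkMatrix G m ^ t) x y - (d : ℝ) ^ t / Fintype.card V| ≤ (d : ℝ) ^ t * e) (k : ℕ)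
    (hpos : 0 ≤ (d : ℝ) ^ (s + 1) * (1 / Fintype.card V - e) -
      (s + 2) * ((2 * (s + 2) + 2 * k + 2 * r) * (d : ℝ) ^ (s - 1))) :
    (#(level G H k) : ℝ) * ((#(adjPairs H) - 2 * (2 * k * r)) *
      ((d : ℝ) ^ (s + 1) * (1 / Fintype.card V - e) -
      (s + 2) * ((2 * (s + 2) + 2 * k + 2 * r) * (d : ℝ) ^ (s - 1)))) ≤
    #(level G H (k + 1)) *
      (2 * (k + 1) * ((d : ℝ) ^ (s + 2) * (1 / Fintype.card V + e))) := by
  have h := (Nat.cast_le (α := ℝ)).2 (sum_backwardGood_le G H hs k)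
  push_cast at h
  rw [← nsmul_eq_mul, ← nsmul_eq_mul (#(level G H (k + 1)))]
  refine (card_nsmul_le_sum _ _ _ fun m hm => ?_).trans
    (h.trans (sum_le_card_nsmul _ _ _ fun m hm => ?_))
  · have hm2 := (mem_filter.1 hm).2
    have := card_backwardGood_ge hs hHG (mem_filter.1 hm).1 hd hr (hmix (s + 1) le_rfl m)
    rw [hm2] at this
    push_cast at this
    exact this hpos
  · have hm2 := (mem_filter.1 hm).2
    have := card_forwardWalks_le (H := H) (hmix (s + 2) (by omega) m)
    rw [hm2] at this
    push_cast at this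
    exact this

end Levels

section Translation
open scoped Classical

variable {V : Type*} [Fintype V] [DecidableEq V]

/-- The edge set of the matching given by an involution. -/
def matchingEdges (m : Equiv.Perm V) : Finset (Sym2 V) := univ.image fun v => s(v, m v)

lemma mem_matchingEdges {m : Equiv.Perm V} (hm : ∀ v, m (m v) = v) {a b : V} :
    s(a, b) ∈ matchingEdges m ↔ b = m a := by
  simp only [matchingEdges, mem_image, mem_univ, true_and, Sym2.eq_iff]
  constructor
  · rintro ⟨v, ⟨rfl, rfl⟩ | ⟨rfl, rfl⟩⟩
    · rfl
    · rw [hm]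
  · rintro rfl
    exact ⟨a, Or.inl ⟨rfl, rfl⟩⟩

lemma isPM_matchingEdges {G : SimpleGraph V} {m : Equiv.Perm V} (hm : m ∈ pmPerms G) :
    IsPM G (matchingEdges m) := by
  obtain ⟨hm1, hm2⟩ := mem_pmPerms.1 hm
  refine ⟨fun e he => ?_, fun v => ⟨s(v, m v), ⟨?_, Sym2.mem_mk_left _ _⟩, ?_⟩⟩
  · simp only [matchingEdges, mem_image, mem_univ, true_and] at he
    obtain ⟨v, rfl⟩ := he
    exact hm2 v
  · exact (mem_matchingEdges hm1).2 rfl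
  · rintro e ⟨he, hv⟩
    obtain ⟨w, rfl⟩ := Sym2.mem_iff_exists.1 hv
    rw [(mem_matchingEdges hm1).1 he]

lemma matchingEdges_injOn (G : SimpleGraph V) :
    Set.InjOn (matchingEdges (V := V)) (pmPerms G : Set (Equiv.Perm V)) := by
  intro m hm m' hm' h
  ext v
  have h1 : s(v, m v) ∈ matchingEdges m := (mem_matchingEdges (mem_pmPerms.1 hm).1).2 rfl
  rw [h] at h1
  exact (mem_matchingEdges (mem_pmPerms.1 hm').1).1 h1

lemma exists_matchingEdges_eq {G : SimpleGraph V} {M : Finset (Sym2 V)} (hM : IsPM G M) :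
    ∃ m ∈ pmPerms G, matchingEdges m = M := by
  have hex : ∀ v, ∃ w, s(v, w) ∈ M := by
    intro v
    obtain ⟨e, ⟨he, hv⟩, -⟩ := hM.2 v
    obtain ⟨w, rfl⟩ := Sym2.mem_iff_exists.1 hv
    exact ⟨w, he⟩
  choose f hf using hex
  have huniq : ∀ v w, s(v, w) ∈ M → w = f v := by
    intro v w hw
    have := (hM.2 v).unique ⟨hw, Sym2.mem_mk_left _ _⟩ ⟨hf v, Sym2.mem_mk_left _ _⟩
    exact Sym2.congr_right.1 this
  have hinv : Function.Involutive f := fun v =>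
    (huniq (f v) v (by rw [Sym2.eq_swap]; exact hf v)).symm
  refine ⟨hinv.toPerm, mem_pmPerms.2 ⟨hinv, fun v => hM.1 _ (hf v)⟩, ?_⟩
  ext e
  induction e using Sym2.ind with
  | _ a b =>
    rw [mem_matchingEdges (m := hinv.toPerm) hinv]
    constructor
    · rintro rfl; exact hf a
    · intro h; exact huniq a b h

lemma pmCount_eq (G : SimpleGraph V) : pmCount G = #(pmPerms G) := by
  rw [← card_image_of_injOn (matchingEdges_injOn G)]
  refine Nat.subtype_card _ fun M => ?_
  rw [mem_image]
  constructor
  · rintro ⟨m, hm, rfl⟩; exact isPM_matchingEdges hm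
  · intro h; exact exists_matchingEdges_eq h

variable {G : SimpleGraph V} {N : Finset (Sym2 V)}

lemma fromEdgeSet_adj_iff (hN : ∀ e ∈ N, e ∈ G.edgeSet) {a b : V} :
    (SimpleGraph.fromEdgeSet (N : Set (Sym2 V))).Adj a b ↔ s(a, b) ∈ N := by
  rw [SimpleGraph.fromEdgeSet_adj, mem_coe, and_iff_left_iff_imp]
  intro h
  exact (SimpleGraph.mem_edgeSet G |>.1 (hN _ h)).ne

lemma card_hit_eq (hN : ∀ e ∈ N, e ∈ G.edgeSet) {m : Equiv.Perm V} (hm : m ∈ pmPerms G) :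
    #(hit (SimpleGraph.fromEdgeSet (N : Set (Sym2 V))) m) = 2 * #(matchingEdges m ∩ N) := by
  obtain ⟨hm1, hm2⟩ := mem_pmPerms.1 hm
  rw [card_eq_sum_card_fiberwise (f := fun v => s(v, m v)) (t := matchingEdges m ∩ N)]
  · rw [sum_const_nat (m := 2), mul_comm]
    intro e he
    rw [mem_inter] at he
    obtain ⟨he1, he2⟩ := he
    simp only [matchingEdges, mem_image, mem_univ, true_and] at he1
    obtain ⟨v, rfl⟩ := he1
    rw [← card_pair (hm2 v).ne]
    congr 1
    ext w
    simp only [mem_filter, mem_hit, fromEdgeSet_adj_iff hN, mem_insert, mem_singleton, Sym2.eq_iff]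
    constructor
    · rintro ⟨-, ⟨h, -⟩ | ⟨h, -⟩⟩
      · exact Or.inl h
      · exact Or.inr h
    · rintro (rfl | rfl)
      · exact ⟨he2, Or.inl ⟨rfl, rfl⟩⟩
      · refine ⟨?_, Or.inr ⟨rfl, hm1 v⟩⟩
        rw [hm1, Sym2.eq_swap]; exact he2
  · intro v hv
    rw [mem_coe, mem_hit, fromEdgeSet_adj_iff hN] at hv
    rw [mem_coe, mem_inter]
    exact ⟨(mem_matchingEdges hm1).2 rfl, hv⟩

lemma interProb_eq (hN : ∀ e ∈ N, e ∈ G.edgeSet) (k : ℕ) :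
    interProb G N k =
      #(level G (SimpleGraph.fromEdgeSet (N : Set (Sym2 V))) k) / #(pmPerms G) := by
  rw [interProb, pmCount_eq]
  congr 2
  have hinj : Set.InjOn matchingEdges
      (level G (SimpleGraph.fromEdgeSet (N : Set (Sym2 V))) k : Set (Equiv.Perm V)) :=
    (matchingEdges_injOn G).mono fun m hm => (mem_filter.1 (mem_coe.1 hm)).1
  rw [← card_image_of_injOn hinj]
  refine Nat.subtype_card _ fun M => ?_
  rw [mem_image]
  constructor
  · rintro ⟨m, hm, rfl⟩
    rw [level, mem_filter] at hm
    refine ⟨isPM_matchingEdges hm.1, ?_⟩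
    have := card_hit_eq hN hm.1
    omega
  · rintro ⟨hM, hk⟩
    obtain ⟨m, hm, rfl⟩ := exists_matchingEdges_eq hM
    refine ⟨m, ?_, rfl⟩
    rw [level, mem_filter, card_hit_eq hN hm, hk]
    exact ⟨hm, rfl⟩

lemma card_neighbors_fromEdgeSet {r : ℕ} (hN : SpanningRegular G N r) (v : V) :
    #{u | (SimpleGraph.fromEdgeSet (N : Set (Sym2 V))).Adj v u} = r := by
  rw [← hN.2 v]
  symm
  rw [← card_image_of_injective _ (Sym2.mkEmbedding v).injective]
  refine Nat.subtype_card _ fun e => ?_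
  simp only [mem_image, mem_filter, mem_univ, true_and, fromEdgeSet_adj_iff hN.1]
  constructor
  · rintro ⟨u, hu, rfl⟩; exact ⟨hu, Sym2.mem_mk_left _ _⟩
  · rintro ⟨he, hv⟩
    obtain ⟨w, rfl⟩ := Sym2.mem_iff_exists.1 hv
    exact ⟨w, he, rfl⟩

lemma card_adjPairs (H : SimpleGraph V) : #(adjPairs H) = ∑ v, #{u | H.Adj v u} := by
  simp_rw [adjPairs, card_filter, Fintype.sum_prod_type]

lemma card_neighbors_of_regularDeg {d : ℕ} (hG : RegularDeg G d) (v : V) :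
    #{u | G.Adj v u} = d := by
  rw [← hG v]
  symm
  exact Nat.subtype_card _ fun u => by simp

/-- In a dense regular graph, robust expansion extends to all large sets, capped at the number
of vertices. -/
lemma expansion_of_robustExpander {d : ℕ} (hd : ∀ v, #{u | G.Adj v u} = d) {ν τ ν' : ℝ}
    (hexp : RobustExpander G ν τ) (hν : ν' ≤ ν) (hτ : (τ + ν') * Fintype.card V ≤ d)
    (S : Finset V) (hS : τ * Fintype.card V ≤ #S) :
    min (Fintype.card V : ℝ) (#S + ν' * Fintype.card V) ≤
      #{v | ν' * Fintype.card V ≤ (#{u ∈ S | G.Adj v u} : ℝ)} := by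
  have hn : (0 : ℝ) ≤ Fintype.card V := Nat.cast_nonneg _
  by_cases h : (#S : ℝ) ≤ (1 - τ) * Fintype.card V
  · have h1 := hexp (S : Set V) (by simpa using hS) (by simpa using h)
    rw [Nat.card_coe_set_eq, Nat.card_coe_set_eq, Set.ncard_coe_finset] at h1
    refine (min_le_right _ _).trans (le_trans (by nlinarith) (h1.trans ?_))
    norm_cast
    rw [← Set.ncard_coe_finset]
    refine Set.ncard_le_ncard ?_ (Set.toFinite _)
    intro v hv
    simp only [RN, Set.mem_ofPred_eq] at hv
    simp only [coe_filter, mem_univ, true_and, Set.mem_ofPred_eq]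
    refine le_trans (mul_le_mul_of_nonneg_right hν hn) (hv.trans (le_of_eq ?_))
    congr 1
    exact Nat.subtype_card _ fun u => by simp
  · push Not at h
    have huniv : ({v | ν' * Fintype.card V ≤ (#{u ∈ S | G.Adj v u} : ℝ)} : Finset V) = univ := by
      rw [filter_eq_self]
      intro v _
      have h1 : d ≤ #{u ∈ S | G.Adj v u} + #Sᶜ := by
        rw [← hd v]
        refine (card_le_card ?_).trans (card_union_le _ _)
        intro u hu
        simp only [mem_filter, mem_univ, true_and, mem_union, mem_compl] at hu ⊢
        tauto
      have h2 : #S + #Sᶜ = Fintype.card V := card_add_card_compl S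
      have h1' := (Nat.cast_le (α := ℝ)).2 h1
      have h2' := congrArg (Nat.cast (R := ℝ)) h2
      push_cast at h1' h2'
      linarith
    rw [huniv, card_univ]
    exact min_le_left _ _

end Translation

section Poisson

lemma hasSum_poissonPMF (lam : ℝ) : HasSum (poissonPMF lam) 1 := by
  have h := (NormedSpace.expSeries_div_hasSum_exp (𝔸 := ℝ) lam).mul_left (Real.exp (-lam))
  rw [← Real.exp_eq_exp_ℝ, ← Real.exp_add, neg_add_cancel, Real.exp_zero] at h
  have hfun : poissonPMF lam = fun k => Real.exp (-lam) * (lam ^ k / k.factorial) :=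
    funext fun k => mul_div_assoc _ _ _
  rwa [hfun]

lemma poissonPMF_pos {lam : ℝ} (h : 0 < lam) (k : ℕ) : 0 < poissonPMF lam k := by
  unfold poissonPMF; positivity

lemma poissonPMF_succ (lam : ℝ) (k : ℕ) :
    (k + 1) * poissonPMF lam (k + 1) = lam * poissonPMF lam k := by
  have : (k.factorial : ℝ) ≠ 0 := by positivity
  have h' : (k + 1 : ℝ) ≠ 0 := by positivity
  simp only [poissonPMF, Nat.factorial_succ]
  push_cast
  field_simp
  ring

lemma le_sum_poissonPMF {lam θ : ℝ} (h : 0 < lam) {K : ℕ} (hθ : lam ≤ θ * (K + 1)) :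
    1 - θ ≤ ∑ k ∈ range (K + 1), poissonPMF lam k := by
  have hs := (hasSum_poissonPMF lam).summable
  have h1 := hs.sum_add_tsum_nat_add (K + 1)
  have h2 := hs.sum_add_tsum_nat_add K
  rw [(hasSum_poissonPMF lam).tsum_eq] at h1 h2
  have hsK := (summable_nat_add_iff K).2 hs
  have h3 : ∑' k, poissonPMF lam (k + (K + 1)) ≤ ∑' k, θ * poissonPMF lam (k + K) := by
    refine ((summable_nat_add_iff (K + 1)).2 hs).tsum_le_tsum (fun k => ?_) (hsK.mul_left θ)
    have h4 := poissonPMF_succ lam (k + K)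
    have hp := poissonPMF_pos h (k + K)
    have hp' := poissonPMF_pos h (k + K + 1)
    have hθ' : 0 ≤ θ := by
      by_contra! hneg
      have : θ * (K + 1) ≤ 0 := mul_nonpos_of_nonpos_of_nonneg hneg.le (by positivity)
      linarith
    have hk : lam ≤ θ * ((k + K : ℕ) + 1) :=
      hθ.trans (mul_le_mul_of_nonneg_left (by push_cast; linarith [(Nat.cast_nonneg k : (0:ℝ) ≤ k)]) hθ')
    have h5 : (((k + K : ℕ) : ℝ) + 1) * poissonPMF lam (k + K + 1) ≤
        (((k + K : ℕ) : ℝ) + 1) * (θ * poissonPMF lam (k + K)) := by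
      rw [h4]; nlinarith
    exact le_of_mul_le_mul_left h5 (by positivity)
  rw [tsum_mul_left] at h3
  have hθ' : 0 ≤ θ := by
    by_contra! hneg
    have : θ * (K + 1) ≤ 0 := mul_nonpos_of_nonpos_of_nonneg hneg.le (by positivity)
    linarith
  have h6 : ∑' k, poissonPMF lam (k + K) ≤ 1 := by
    have := sum_nonneg fun k (_ : k ∈ range K) => (poissonPMF_pos h k).le
    linarith
  nlinarith

lemma poissonPMF_approx {lam η ξ θ : ℝ} {π : ℕ → ℝ} {K : ℕ} (hlam : 0 < lam)
    (hπ : ∀ k, 0 ≤ π k) (hsum : HasSum π 1) (hη : 0 ≤ η)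
    (hKη : K * η ≤ ξ) (hη1 : η ≤ 1) (hξ : ξ ≤ 1 / 4) (hθ : θ ≤ 1 / 4)
    (hlo : ∀ k < K, (1 - η) * (lam * π k) ≤ (k + 1) * π (k + 1))
    (hup : ∀ k < K, (k + 1) * π (k + 1) ≤ (1 + η) * (lam * π k))
    (htail : 1 - θ ≤ ∑ k ∈ range (K + 1), π k) (hK : lam ≤ θ * (K + 1)) :
    (1 / 2) * ∑' k, |π k - poissonPMF lam k| ≤ 2 * ξ + 2 * θ := by
  set p := poissonPMF lam with hp
  have hp0 : ∀ k, 0 < p k := poissonPMF_pos hlam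
  have hps : HasSum p 1 := hasSum_poissonPMF lam
  have hξ0 : 0 ≤ ξ := le_trans (by positivity) hKη
  have hθ0 : 0 ≤ θ := by
    by_contra! hneg
    have : θ * (K + 1) ≤ 0 := mul_nonpos_of_nonpos_of_nonneg hneg.le (by positivity)
    linarith
  have hratio : ∀ k ≤ K, (1 - η) ^ k * (π 0 * p k) ≤ π k * p 0 ∧
      π k * p 0 ≤ (1 + η) ^ k * (π 0 * p k) := by
    intro k
    induction k with
    | zero => simp
    | succ k ih =>
      intro hk
      obtain ⟨ih1, ih2⟩ := ih (by omega)
      have hk1 : (0 : ℝ) < k + 1 := by positivity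
      have hsucc : (k + 1 : ℝ) * p (k + 1) = lam * p k := poissonPMF_succ lam k
      constructor
      · refine le_of_mul_le_mul_left ?_ hk1
        calc (k + 1 : ℝ) * ((1 - η) ^ (k + 1) * (π 0 * p (k + 1)))
            = (1 - η) ^ (k + 1) * π 0 * ((k + 1) * p (k + 1)) := by ring
          _ = (1 - η) * lam * ((1 - η) ^ k * (π 0 * p k)) := by rw [hsucc]; ring
          _ ≤ (1 - η) * lam * (π k * p 0) :=
            mul_le_mul_of_nonneg_left ih1 (mul_nonneg (by linarith) hlam.le)
          _ = (1 - η) * (lam * π k) * p 0 := by ring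
          _ ≤ (k + 1) * π (k + 1) * p 0 :=
            mul_le_mul_of_nonneg_right (hlo k (by omega)) (hp0 0).le
          _ = _ := by ring
      · refine le_of_mul_le_mul_left ?_ hk1
        calc (k + 1 : ℝ) * (π (k + 1) * p 0) = (k + 1) * π (k + 1) * p 0 := by ring
          _ ≤ (1 + η) * (lam * π k) * p 0 :=
            mul_le_mul_of_nonneg_right (hup k (by omega)) (hp0 0).le
          _ = (1 + η) * lam * (π k * p 0) := by ring
          _ ≤ (1 + η) * lam * ((1 + η) ^ k * (π 0 * p k)) :=
            mul_le_mul_of_nonneg_left ih2 (mul_nonneg (by linarith) hlam.le)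
          _ = (1 + η) ^ (k + 1) * π 0 * ((k + 1) * p (k + 1)) := by rw [hsucc]; ring
          _ = _ := by ring
  have hbern : 1 - ξ ≤ (1 - η) ^ K := by
    have := one_add_mul_le_pow (a := -η) (by linarith) K
    rw [← sub_eq_add_neg] at this
    linarith
  have hlo' : ∀ k ≤ K, (1 - ξ) * (π 0 * p k) ≤ π k * p 0 := fun k hk =>
    le_trans (mul_le_mul_of_nonneg_right
      (hbern.trans (pow_le_pow_of_le_one (by linarith) (by linarith) hk))
      (mul_nonneg (hπ 0) (hp0 k).le)) (hratio k hk).1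
  have hup' : ∀ k ≤ K, (1 - ξ) * (π k * p 0) ≤ π 0 * p k := by
    intro k hk
    have h1 : (1 - ξ) * (1 + η) ^ k ≤ 1 :=
      calc (1 - ξ) * (1 + η) ^ k ≤ (1 - η) ^ k * (1 + η) ^ k :=
            mul_le_mul_of_nonneg_right
              (hbern.trans (pow_le_pow_of_le_one (by linarith) (by linarith) hk)) (by positivity)
        _ = (1 - η ^ 2) ^ k := by rw [← mul_pow]; ring
        _ ≤ 1 := pow_le_one₀ (by nlinarith) (by nlinarith)
    calc (1 - ξ) * (π k * p 0) ≤ (1 - ξ) * ((1 + η) ^ k * (π 0 * p k)) :=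
          mul_le_mul_of_nonneg_left (hratio k hk).2 (by linarith)
      _ = (1 - ξ) * (1 + η) ^ k * (π 0 * p k) := by ring
      _ ≤ 1 * (π 0 * p k) := mul_le_mul_of_nonneg_right h1 (mul_nonneg (hπ 0) (hp0 k).le)
      _ = _ := one_mul _
  have hzero : (1 - ξ) * (1 - θ) * p 0 ≤ π 0 := by
    have h1 : (1 - ξ) * ((∑ k ∈ range (K + 1), π k) * p 0) ≤ π 0 * ∑ k ∈ range (K + 1), p k := by
      rw [sum_mul, mul_sum, mul_sum]
      exact sum_le_sum fun k hk => hup' k (by have := mem_range.1 hk; omega)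
    have h2 : ∑ k ∈ range (K + 1), p k ≤ 1 :=
      sum_le_hasSum _ (fun k _ => (hp0 k).le) hps
    calc (1 - ξ) * (1 - θ) * p 0 ≤ (1 - ξ) * ((∑ k ∈ range (K + 1), π k) * p 0) := by
          rw [mul_assoc]
          exact mul_le_mul_of_nonneg_left (mul_le_mul_of_nonneg_right htail (hp0 0).le)
            (by linarith)
      _ ≤ π 0 * ∑ k ∈ range (K + 1), p k := h1
      _ ≤ π 0 * 1 := mul_le_mul_of_nonneg_left h2 (hπ 0)
      _ = π 0 := mul_one _
  set c := (1 - ξ) ^ 2 * (1 - θ) with hc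
  have hc1 : c ≤ 1 := mul_le_one₀ (pow_le_one₀ (by linarith) (by linarith)) (by linarith)
    (by linarith)
  have hc0 : 0 ≤ c := mul_nonneg (sq_nonneg _) (by linarith)
  have hmin : ∀ k ≤ K, c * p k ≤ π k := by
    intro k hk
    refine le_of_mul_le_mul_right ?_ (hp0 0)
    calc c * p k * p 0 = (1 - ξ) * ((1 - ξ) * (1 - θ) * p 0 * p k) := by rw [hc]; ring
      _ ≤ (1 - ξ) * (π 0 * p k) := mul_le_mul_of_nonneg_left
        (mul_le_mul_of_nonneg_right hzero (hp0 k).le) (by linarith)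
      _ ≤ _ := hlo' k hk
  have hf : HasSum (fun k => if k ∈ range (K + 1) then c * p k else 0)
      (∑ k ∈ range (K + 1), c * p k) := by
    rw [← sum_congr rfl fun k hk => if_pos hk]
    exact hasSum_sum_of_ne_finset_zero fun k hk => if_neg hk
  have hbound : ∑' k, |π k - p k| ≤ 1 + 1 - 2 * ∑ k ∈ range (K + 1), c * p k := by
    refine hasSum_le (fun k => ?_) (hsum.summable.sub hps.summable).abs.hasSum
      ((hsum.add hps).sub (hf.mul_left 2))
    split_ifs with hk
    · have h1 := hmin k (by have := mem_range.1 hk; omega)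
      have h2 : c * p k ≤ p k := mul_le_of_le_one_left (hp0 k).le hc1
      rw [abs_le]; constructor <;> linarith
    · have h1 := hπ k
      have h2 := (hp0 k).le
      rw [abs_le]; constructor <;> linarith
  have htp := le_sum_poissonPMF hlam hK
  rw [← mul_sum] at hbound
  have h3 : c * (1 - θ) ≤ c * ∑ k ∈ range (K + 1), p k := mul_le_mul_of_nonneg_left htp hc0
  have h4 : 1 - 2 * ξ - 2 * θ ≤ c * (1 - θ) := by
    have h5 : 1 - 2 * ξ ≤ (1 - ξ) ^ 2 := by nlinarith
    have h6 : 1 - 2 * θ ≤ (1 - θ) ^ 2 := by nlinarith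
    calc 1 - 2 * ξ - 2 * θ ≤ (1 - 2 * ξ) * (1 - 2 * θ) := by nlinarith
      _ ≤ (1 - ξ) ^ 2 * (1 - θ) ^ 2 := mul_le_mul h5 h6 (by linarith) (sq_nonneg _)
      _ = _ := by rw [hc]; ring
  linarith

end Poisson

section Ratios
open scoped Classical

variable {V : Type*} [Fintype V] [DecidableEq V]

lemma card_adjPairs_of_regular {H : SimpleGraph V} {r : ℕ} (hr : ∀ v, #{u | H.Adj v u} = r) :
    #(adjPairs H) = r * Fintype.card V := by
  rw [card_adjPairs, sum_congr rfl fun v _ => hr v, sum_const, smul_eq_mul, card_univ, mul_comm]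

lemma le_main_term {n d e κ c x : ℝ} (hn : 0 < n) (hd : 0 ≤ d) (he : e * n ≤ κ)
    (hx : c * x * n ≤ κ * d ^ 2) (j : ℕ) :
    d ^ (j + 2) / n * (1 - 2 * κ) ≤ d ^ (j + 2) * (1 / n - e) - c * (x * d ^ j) := by
  rw [← le_div_iff₀ hn] at he hx
  have h1 := mul_le_mul_of_nonneg_right hx (pow_nonneg hd j)
  have h2 := mul_le_mul_of_nonneg_left he (pow_nonneg hd (j + 2))
  have h3 : κ * d ^ 2 / n * d ^ j = d ^ (j + 2) * (κ / n) := by ring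
  have h4 : d ^ (j + 2) / n * (1 - 2 * κ) =
    d ^ (j + 2) * (1 / n) - 2 * (d ^ (j + 2) * (κ / n)) := by ring
  rw [h4]
  linarith

lemma level_ratio {G H : SimpleGraph V} {d r s K k : ℕ} {e κ : ℝ} (hs : 1 ≤ s) (hHG : H ≤ G)
    (hd : ∀ v, #{u | G.Adj v u} = d) (hr : ∀ v, #{u | H.Adj v u} = r)
    (hmix : ∀ t, s + 1 ≤ t → ∀ m : Equiv.Perm V, ∀ x y,
      |(walkMatrix G m ^ t) x y - (d : ℝ) ^ t / Fintype.card V| ≤ (d : ℝ) ^ t * e)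
    (hn : 0 < Fintype.card V) (hd0 : 0 < d) (hκ0 : 0 ≤ κ) (hκ : κ ≤ 1 / 8)
    (he : e * Fintype.card V ≤ κ)
    (hJ : (s + 2) * (2 * (s + 2) + 2 * K + 2 * r) * (Fintype.card V : ℝ) ≤ κ * (d : ℝ) ^ 2)
    (hK : 4 * K ≤ κ * Fintype.card V) (hk : k < K) :
    (1 - 4 * κ) * (r * Fintype.card V / (2 * d) * #(level G H k)) ≤
        (k + 1) * #(level G H (k + 1)) ∧
      (k + 1) * #(level G H (k + 1)) ≤
        (1 + 4 * κ) * (r * Fintype.card V / (2 * d) * #(level G H k)) := by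
  have hA := card_adjPairs_of_regular hr
  have hup := level_succ_le hHG hd (fun v => (hr v).le) hmix k
  have hlo := le_level_succ (k := k) hs hHG hd (fun v => (hr v).le) hmix
  rw [hA] at hup hlo
  obtain ⟨s, rfl⟩ := Nat.exists_eq_add_of_le' hs
  rw [Nat.add_sub_cancel] at hlo
  push_cast at hup hlo hJ
  set n : ℝ := (Fintype.card V : ℝ) with hndef
  have hn0 : 0 < n := Nat.cast_pos.2 hn
  have hd0' : (0 : ℝ) < d := by exact_mod_cast hd0
  have hkK : (k : ℝ) + 1 ≤ K := by exact_mod_cast hk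
  have hk0 : (0 : ℝ) ≤ k := by positivity
  have hr0 : (0 : ℝ) ≤ r := by positivity
  have hs0 : (0 : ℝ) ≤ s := by positivity
  set L : ℝ := (#(level G H k) : ℝ) with hL
  set L' : ℝ := (#(level G H (k + 1)) : ℝ) with hL'
  have hL0 : 0 ≤ L := by positivity
  have hL0' : 0 ≤ L' := by positivity
  have he' : e ≤ κ / n := by rwa [le_div_iff₀ hn0]
  have hQ : ∀ x : ℝ, x ≤ K → ∀ j : ℕ, (d : ℝ) ^ (j + 2) / n * (1 - 2 * κ) ≤
      (d : ℝ) ^ (j + 2) * (1 / n - e) -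
        (s + 1 + 2) * ((2 * (s + 1 + 2) + 2 * x + 2 * r) * (d : ℝ) ^ j) := by
    intro x hx j
    refine le_main_term hn0 hd0'.le he (le_trans ?_ hJ) j
    gcongr
  have hE : 1 / n + e ≤ (1 + κ) / n := by rw [add_div]; linarith
  have hlam : r * n / (2 * d) * L * (2 * d) = r * n * L := by field_simp
  set lam : ℝ := r * n / (2 * d) with hlamdef
  have hlam0 : 0 ≤ lam := by positivity
  constructor
  · have hQ1 := hQ k (by linarith) s
    have hpos : 0 ≤ (d : ℝ) ^ (s + 2) / n * (1 - 2 * κ) :=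
      mul_nonneg (by positivity) (by linarith)
    have h1 := hlo (hpos.trans hQ1)
    have h2 : r * n * (1 - κ) ≤ r * n - 2 * (2 * k * r) := by
      have : 0 ≤ κ * n - 4 * k := by linarith only [hK, hkK]
      linarith only [mul_nonneg hr0 this]
    have h3 : L * (r * n * (1 - κ) * ((d : ℝ) ^ (s + 2) / n * (1 - 2 * κ))) ≤
        L' * (2 * (k + 1) * (d ^ (s + 1 + 2) * ((1 + κ) / n))) := by
      refine le_trans ?_ (h1.trans ?_)
      · refine mul_le_mul_of_nonneg_left (mul_le_mul h2 hQ1 hpos ?_) hL0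
        exact le_trans (mul_nonneg (by positivity) (by linarith)) h2
      · gcongr
    have hd2 : 0 < (d : ℝ) ^ (s + 2) / n := by positivity
    have h4 : (1 - κ) * (1 - 2 * κ) * (lam * L) ≤ (k + 1) * L' * (1 + κ) := by
      refine le_of_mul_le_mul_left (a := (d : ℝ) ^ (s + 2) / n * (2 * d)) ?_ (by positivity)
      calc (d : ℝ) ^ (s + 2) / n * (2 * d) * ((1 - κ) * (1 - 2 * κ) * (lam * L))
          = (d : ℝ) ^ (s + 2) / n * ((1 - κ) * (1 - 2 * κ)) * (lam * L * (2 * d)) := by ring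
        _ = L * (r * n * (1 - κ) * ((d : ℝ) ^ (s + 2) / n * (1 - 2 * κ))) := by rw [hlam]; ring
        _ ≤ _ := h3
        _ = _ := by ring
    have h5 : 0 ≤ lam * L := by positivity
    refine le_of_mul_le_mul_right (le_trans ?_ h4) (by linarith : 0 < 1 + κ)
    have h6 : (1 - 4 * κ) * (1 + κ) ≤ (1 - κ) * (1 - 2 * κ) := by
      linarith only [sq_nonneg κ]
    calc (1 - 4 * κ) * (lam * L) * (1 + κ) = (1 - 4 * κ) * (1 + κ) * (lam * L) := by ring
      _ ≤ _ := mul_le_mul_of_nonneg_right h6 h5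
  · have hQ1 := hQ (k + 1) hkK (s + 1)
    have h3 : L' * (2 * (k + 1) * ((d : ℝ) ^ (s + 1 + 2) / n * (1 - 2 * κ))) ≤
        L * (r * n * (d ^ (s + 1 + 1) * ((1 + κ) / n))) := by
      refine le_trans ?_ (hup.trans ?_)
      · gcongr
      · gcongr
    have h4 : (k + 1) * L' * (1 - 2 * κ) ≤ lam * L * (1 + κ) := by
      refine le_of_mul_le_mul_left (a := (d : ℝ) ^ (s + 2) / n * (2 * d)) ?_ (by positivity)
      calc (d : ℝ) ^ (s + 2) / n * (2 * d) * ((k + 1) * L' * (1 - 2 * κ))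
          = L' * (2 * (k + 1) * ((d : ℝ) ^ (s + 1 + 2) / n * (1 - 2 * κ))) := by ring
        _ ≤ _ := h3
        _ = (d : ℝ) ^ (s + 2) / n * (1 + κ) * (r * n * L) := by ring
        _ = _ := by rw [← hlam]; ring
    have h5 : 0 ≤ lam * L := by positivity
    refine le_of_mul_le_mul_right (h4.trans ?_) (by linarith : 0 < 1 - 2 * κ)
    have h6 : (1 + κ) ≤ (1 + 4 * κ) * (1 - 2 * κ) := by
      linarith only [mul_nonneg hκ0 (sub_nonneg.2 hκ)]
    calc lam * L * (1 + κ) ≤ lam * L * ((1 + 4 * κ) * (1 - 2 * κ)) :=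
          mul_le_mul_of_nonneg_left h6 h5
      _ = _ := by ring

end Ratios

section Tail
open scoped Classical

variable {V : Type*} [Fintype V] [DecidableEq V]

lemma sum_card_level (G H : SimpleGraph V) (heven : ∀ m ∈ pmPerms G, Even #(hit H m)) (K : ℕ) :
    ∑ k ∈ range K, #(level G H k) = #{m ∈ pmPerms G | #(hit H m) < 2 * K} := by
  rw [card_eq_sum_card_fiberwise (f := fun m => #(hit H m) / 2) (t := range K)]
  · refine sum_congr rfl fun k hk => congrArg card ?_
    ext m
    simp only [level, mem_filter]
    constructor
    · rintro ⟨h1, h2⟩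
      have := mem_range.1 hk
      exact ⟨⟨h1, by omega⟩, by omega⟩
    · rintro ⟨⟨h1, h2⟩, h3⟩
      obtain ⟨j, hj⟩ := heven m h1
      exact ⟨h1, by omega⟩
  · intro m hm
    have := (mem_filter.1 (mem_coe.1 hm)).2
    simp only [coe_range, Set.mem_Iio]
    omega

lemma level_eq_empty (G H : SimpleGraph V) {k : ℕ} (hk : Fintype.card V < k) :
    level G H k = ∅ := by
  refine filter_eq_empty_iff.2 fun m _ h => ?_
  have := card_le_univ (hit H m)
  omega

lemma hasSum_card_level {G H : SimpleGraph V} (heven : ∀ m ∈ pmPerms G, Even #(hit H m))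
    (hG : (pmPerms G).Nonempty) :
    HasSum (fun k => (#(level G H k) : ℝ) / #(pmPerms G)) 1 := by
  have hpos : (#(pmPerms G) : ℝ) ≠ 0 := Nat.cast_ne_zero.2 hG.card_pos.ne'
  have h := hasSum_sum_of_ne_finset_zero (f := fun k => (#(level G H k) : ℝ) / #(pmPerms G))
    (s := range (Fintype.card V + 1)) (L := SummationFilter.unconditional ℕ) fun k hk => by
      rw [level_eq_empty G H (by simpa using hk), card_empty, Nat.cast_zero, zero_div]
  rwa [← sum_div, ← Nat.cast_sum, sum_card_level G H heven, filter_true_of_mem, div_self hpos] at h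
  intro m _
  have := card_le_univ (hit H m)
  omega

lemma sum_card_hit (G H : SimpleGraph V) :
    ∑ m ∈ pmPerms G, #(hit H m) = ∑ p ∈ adjPairs H, #{m ∈ pmPerms G | m p.1 = p.2} := by
  have h : ∀ m : Equiv.Perm V, #(hit H m) = #{p ∈ adjPairs H | m p.1 = p.2} := by
    intro m
    rw [← card_image_of_injective (hit H m) (f := fun v => (v, m v))
      fun v w h => (Prod.mk.inj h).1]
    congr 1
    ext ⟨a, b⟩
    simp only [mem_image, mem_hit, adjPairs, mem_filter, mem_univ, true_and, Prod.mk.injEq]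
    constructor
    · rintro ⟨v, h, rfl, rfl⟩; exact ⟨h, rfl⟩
    · rintro ⟨h, rfl⟩; exact ⟨a, h, rfl, rfl⟩
  rw [sum_congr rfl fun m _ => h m]
  exact sum_card_bipartiteAbove_eq_sum_card_bipartiteBelow
    (r := fun (m : Equiv.Perm V) (p : V × V) => m p.1 = p.2)

lemma card_pmPerms_apply_eq_le {G : SimpleGraph V} {d s : ℕ} {e κ : ℝ}
    (hd : ∀ v, #{u | G.Adj v u} = d)
    (hmix : ∀ t, s + 1 ≤ t → ∀ m : Equiv.Perm V, ∀ x y,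
      |(walkMatrix G m ^ t) x y - (d : ℝ) ^ t / Fintype.card V| ≤ (d : ℝ) ^ t * e)
    (hn : 0 < Fintype.card V) (hd0 : 0 < d) (hκ : κ ≤ 1 / 8)
    (he : e * Fintype.card V ≤ κ)
    (hJ : (s + 2) * (2 * (s + 2) + 2 + 2) * (Fintype.card V : ℝ) ≤ κ * (d : ℝ) ^ 2)
    {a b : V} (hab : G.Adj a b) :
    (#{m ∈ pmPerms G | m a = b} : ℝ) * d ≤ 2 * #(pmPerms G) := by
  set N : Finset (Sym2 V) := {s(a, b)} with hNdef
  have hN : ∀ e ∈ N, e ∈ G.edgeSet := by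
    intro e he
    rw [mem_singleton.1 he]
    exact hab
  obtain ⟨H, hH⟩ : ∃ H, H = SimpleGraph.fromEdgeSet (N : Set (Sym2 V)) := ⟨_, rfl⟩
  have hadj : ∀ u v, H.Adj u v ↔ u = a ∧ v = b ∨ u = b ∧ v = a := fun u v => by
    rw [hH, fromEdgeSet_adj_iff hN, mem_singleton, Sym2.eq_iff]
  have hHG : H ≤ G := fun u v h => by
    rcases (hadj u v).1 h with ⟨rfl, rfl⟩ | ⟨rfl, rfl⟩
    · exact hab
    · exact hab.symm
  have hr : ∀ v, #{u | H.Adj v u} ≤ 1 := fun v => by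
    refine card_le_one.2 fun u hu w hw => ?_
    rw [mem_filter, hadj] at hu hw
    have := hab.ne
    grind
  have hpairs : (#(adjPairs H) : ℝ) ≤ 2 := by
    have : adjPairs H ⊆ {(a, b), (b, a)} := fun p hp => by
      simpa [adjPairs, hadj, Prod.ext_iff] using hp
    exact_mod_cast (card_le_card this).trans card_le_two
  have hsub : {m ∈ pmPerms G | m a = b} ⊆ level G H (0 + 1) := by
    intro m hm
    obtain ⟨hm1, hm2⟩ := mem_filter.1 hm
    refine mem_filter.2 ⟨hm1, ?_⟩
    rw [hH, card_hit_eq hN hm1, inter_eq_right.2, card_singleton]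
    exact singleton_subset_iff.2 ((mem_matchingEdges (mem_pmPerms.1 hm1).1).2 hm2.symm)
  have h1 := level_succ_le hHG hd hr hmix 0
  have hn0 : (0 : ℝ) < Fintype.card V := Nat.cast_pos.2 hn
  have hd0' : (0 : ℝ) < d := Nat.cast_pos.2 hd0
  have h2 := le_main_term hn0 hd0'.le he hJ s
  have h3 : (#{m ∈ pmPerms G | m a = b} : ℝ) ≤ #(level G H (0 + 1)) :=
    Nat.cast_le.2 (card_le_card hsub)
  have h4 : (#(level G H 0) : ℝ) ≤ #(pmPerms G) := Nat.cast_le.2 (card_filter_le _ _)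
  have hE : 1 / (Fintype.card V : ℝ) + e ≤ (1 + κ) / Fintype.card V := by
    rw [← le_div_iff₀ hn0] at he
    rw [add_div]; linarith
  have he0 : 0 ≤ e := nonneg_of_mul_nonneg_right
    ((abs_nonneg _).trans (hmix (s + 1) le_rfl 1 a a)) (by positivity)
  have hκ0 : 0 ≤ κ := by
    by_contra! hneg
    have h5 : 0 ≤ κ * (d : ℝ) ^ 2 := le_trans (by positivity) hJ
    nlinarith [pow_pos hd0' 2]
  set n : ℝ := (Fintype.card V : ℝ)
  set x : ℝ := (#{m ∈ pmPerms G | m a = b} : ℝ)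
  push_cast at h1
  have h5 : x * ((d : ℝ) ^ (s + 2) / n * (1 - 2 * κ)) ≤
      #(pmPerms G) * ((d : ℝ) ^ (s + 1) * ((1 + κ) / n)) := by
    have h6 : (#(level G H (0 + 1)) : ℝ) * (2 * ((d : ℝ) ^ (s + 2) / n * (1 - 2 * κ))) ≤
        #(level G H 0) * (2 * ((d : ℝ) ^ (s + 1) * ((1 + κ) / n))) := by
      refine le_trans ?_ (h1.trans ?_)
      · refine mul_le_mul_of_nonneg_left ?_ (Nat.cast_nonneg _)
        linarith
      · refine mul_le_mul_of_nonneg_left ?_ (Nat.cast_nonneg _)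
        exact mul_le_mul hpairs (mul_le_mul_of_nonneg_left hE (by positivity))
          (mul_nonneg (by positivity) (by positivity)) (by norm_num)
    have h7 : 0 ≤ (d : ℝ) ^ (s + 2) / n * (1 - 2 * κ) :=
      mul_nonneg (by positivity) (by linarith)
    have h8 : 0 ≤ (d : ℝ) ^ (s + 1) * ((1 + κ) / n) := by positivity
    have h9 := mul_le_mul_of_nonneg_right h3 h7
    have h10 := mul_le_mul_of_nonneg_right h4 h8
    linarith
  have h6 : x * d * (1 - 2 * κ) ≤ #(pmPerms G) * (1 + κ) := by
    refine le_of_mul_le_mul_left (a := (d : ℝ) ^ (s + 1) / n) ?_ (by positivity)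
    calc _ = x * ((d : ℝ) ^ (s + 2) / n * (1 - 2 * κ)) := by ring
      _ ≤ _ := h5
      _ = _ := by ring
  refine le_of_mul_le_mul_right (h6.trans ?_) (by linarith : 0 < 1 - 2 * κ)
  have h7 : 1 + κ ≤ 2 * (1 - 2 * κ) := by linarith
  have := mul_le_mul_of_nonneg_left h7 (Nat.cast_nonneg #(pmPerms G) : (0 : ℝ) ≤ _)
  linarith

lemma le_sum_card_level {G H : SimpleGraph V} {d r K : ℕ} {θ : ℝ} (hHG : H ≤ G)
    (hr : ∀ v, #{u | H.Adj v u} = r) (heven : ∀ m ∈ pmPerms G, Even #(hit H m)) (hd0 : 0 < d)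
    (hedge : ∀ a b, G.Adj a b → (#{m ∈ pmPerms G | m a = b} : ℝ) * d ≤ 2 * #(pmPerms G))
    (hθ : 2 * (r * Fintype.card V / (2 * d)) ≤ θ * ((K : ℝ) + 1)) :
    (1 - θ) * #(pmPerms G) ≤ ∑ k ∈ range (K + 1), (#(level G H k) : ℝ) := by
  have hd0' : (0 : ℝ) < d := Nat.cast_pos.2 hd0
  rw [← Nat.cast_sum, sum_card_level G H heven]
  have h1 : #{m ∈ pmPerms G | #(hit H m) < 2 * (K + 1)} +
      #{m ∈ pmPerms G | ¬ #(hit H m) < 2 * (K + 1)} = #(pmPerms G) :=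
    card_filter_add_card_filter_not _
  have h2 : #{m ∈ pmPerms G | ¬ #(hit H m) < 2 * (K + 1)} * (2 * (K + 1)) ≤
      ∑ m ∈ pmPerms G, #(hit H m) := by
    rw [← smul_eq_mul]
    refine (card_nsmul_le_sum _ (fun m => #(hit H m)) _ fun m hm => ?_).trans
      (sum_le_sum_of_subset (filter_subset _ _))
    exact not_lt.1 (mem_filter.1 hm).2
  have h3 : ((∑ m ∈ pmPerms G, #(hit H m) : ℕ) : ℝ) * d ≤
      r * Fintype.card V * (2 * #(pmPerms G)) := by
    rw [sum_card_hit, Nat.cast_sum, sum_mul, ← Nat.cast_mul, ← card_adjPairs_of_regular hr,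
      ← nsmul_eq_mul]
    refine sum_le_card_nsmul _ _ _ fun p hp => hedge _ _ (hHG ?_)
    exact (mem_filter.1 hp).2
  have h1' := congrArg (Nat.cast (R := ℝ)) h1
  have h2' := (Nat.cast_le (α := ℝ)).2 h2
  push_cast at h1' h2' h3
  set x : ℝ := (#{m ∈ pmPerms G | ¬ #(hit H m) < 2 * (K + 1)} : ℝ)
  have h4 : x * (2 * (K + 1)) * d ≤ θ * (K + 1) * (2 * d) * #(pmPerms G) := by
    have h5 : (r : ℝ) * Fintype.card V * 2 ≤ θ * (K + 1) * (2 * d) := by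
      have h6 := mul_le_mul_of_nonneg_right hθ (by positivity : (0 : ℝ) ≤ 2 * d)
      have h7 : 2 * ((r : ℝ) * Fintype.card V / (2 * d)) * (2 * d) = r * Fintype.card V * 2 := by
        field_simp
      rwa [h7] at h6
    calc x * (2 * (K + 1)) * d ≤ r * Fintype.card V * (2 * #(pmPerms G)) :=
          (mul_le_mul_of_nonneg_right h2' hd0'.le).trans h3
      _ = r * Fintype.card V * 2 * #(pmPerms G) := by ring
      _ ≤ _ := mul_le_mul_of_nonneg_right h5 (Nat.cast_nonneg _)
  have h5 : x ≤ θ * #(pmPerms G) := by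
    refine le_of_mul_le_mul_right (a := 2 * ((K : ℝ) + 1) * d) ?_ (by positivity)
    linarith
  linarith

end Tail

section Assembly
open scoped Classical

variable {V : Type*} [Fintype V] [DecidableEq V]

lemma tsum_abs_interProb_sub_le {G : SimpleGraph V} {N : Finset (Sym2 V)}
    {d r s K : ℕ} {e κ ω : ℝ}
    (hs : 1 ≤ s) (hd : ∀ v, #{u | G.Adj v u} = d) (hN : SpanningRegular G N r) (hr : 1 ≤ r)
    (hmix : ∀ t, s + 1 ≤ t → ∀ m : Equiv.Perm V, ∀ x y,
      |(walkMatrix G m ^ t) x y - (d : ℝ) ^ t / Fintype.card V| ≤ (d : ℝ) ^ t * e)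
    (hn : 0 < Fintype.card V) (hd0 : 0 < d) (hpm : pmCount G ≠ 0) (hK1 : 1 ≤ K)
    (hκ0 : 0 ≤ κ) (hκ : κ ≤ 1 / 8) (he : e * Fintype.card V ≤ κ)
    (hJ : (s + 2) * (2 * (s + 2) + 2 * K + 2 * r) * (Fintype.card V : ℝ) ≤ κ * (d : ℝ) ^ 2)
    (hK : 4 * K ≤ κ * Fintype.card V) (hω : ω ≤ 1 / 4) (hKκ : K * (4 * κ) ≤ ω)
    (hlam : 2 * (r * Fintype.card V / (2 * d)) ≤ ω * ((K : ℝ) + 1)) :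
    (1 / 2) * ∑' k, |interProb G N k - poissonPMF (r * Fintype.card V / (2 * d)) k| ≤
      2 * ω + 2 * ω := by
  have hHr := card_neighbors_fromEdgeSet hN
  have hhit := fun m (hm : m ∈ pmPerms G) => card_hit_eq hN.1 hm
  have hHG : SimpleGraph.fromEdgeSet (N : Set (Sym2 V)) ≤ G := fun a b h =>
    (SimpleGraph.mem_edgeSet G).1 (hN.1 _ ((fromEdgeSet_adj_iff hN.1).1 h))
  have hinter := interProb_eq hN.1
  obtain ⟨H, hH⟩ : ∃ H, H = SimpleGraph.fromEdgeSet (N : Set (Sym2 V)) := ⟨_, rfl⟩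
  have hHr' : ∀ v, #{u | H.Adj v u} = r := fun v => by
    subst hH
    rw [← hHr v]
    congr!
  rw [← hH] at hhit hHG hinter
  have heven : ∀ m ∈ pmPerms G, Even #(hit H m) := fun m hm => by
    rw [hhit m hm]; exact even_two_mul _
  have hpos : (0 : ℝ) < #(pmPerms G) := by
    rw [← pmCount_eq]; exact Nat.cast_pos.2 (Nat.pos_of_ne_zero hpm)
  have hr0 : (1 : ℝ) ≤ r := by exact_mod_cast hr
  have hK1' : (1 : ℝ) ≤ K := by exact_mod_cast hK1
  have hn0 : (0 : ℝ) < Fintype.card V := Nat.cast_pos.2 hn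
  have hd0' : (0 : ℝ) < d := Nat.cast_pos.2 hd0
  have hlam0 : 0 < (r : ℝ) * Fintype.card V / (2 * d) := by positivity
  have hratio := fun k (hk : k < K) =>
    level_ratio hs hHG hd hHr' hmix hn hd0 hκ0 hκ he hJ hK hk
  have hJ' : (s + 2) * (2 * (s + 2) + 2 + 2) * (Fintype.card V : ℝ) ≤ κ * (d : ℝ) ^ 2 := by
    refine le_trans ?_ hJ
    gcongr <;> linarith
  have htail := le_sum_card_level hHG hHr' heven hd0
    (fun a b hab => card_pmPerms_apply_eq_le hd hmix hn hd0 hκ he hJ' hab) hlam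
  refine poissonPMF_approx (η := 4 * κ) (K := K) hlam0 (fun k => ?_) ?_ (by linarith) hKκ
    (by linarith) hω hω (fun k hk => ?_) (fun k hk => ?_) ?_ (by linarith)
  · rw [hinter]; positivity
  · rw [funext hinter]
    exact hasSum_card_level heven (card_pos.1 (Nat.cast_pos.1 hpos))
  · rw [hinter, hinter]
    have := div_le_div_of_nonneg_right (hratio k hk).1 hpos.le
    rwa [mul_div_assoc, mul_div_assoc, mul_div_assoc (_ + _)] at this
  · rw [hinter, hinter]
    have := div_le_div_of_nonneg_right (hratio k hk).2 hpos.le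
    rwa [mul_div_assoc, mul_div_assoc, mul_div_assoc (_ / _)] at this
  · rw [sum_congr rfl fun k _ => hinter k, ← sum_div, le_div_iff₀ hpos]
    exact htail

lemma walkMatrix_mixing_of_robustExpander {G : SimpleGraph V} {d i s : ℕ} {ν ν' τ : ℝ}
    (hd : ∀ v, #{u | G.Adj v u} = d) (hexp : RobustExpander G ν τ) (hν : ν' ≤ ν)
    (hν0 : 0 < ν') (hν1 : ν' ≤ 1) (hτ : (τ + ν') * Fintype.card V ≤ d) (hi : 1 ≤ i * ν')
    (t : ℕ) (ht : s ≤ t) (m : Equiv.Perm V) (x y : V) :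
    |(walkMatrix G m ^ t) x y - (d : ℝ) ^ t / Fintype.card V| ≤
      (d : ℝ) ^ t * (1 - ν' ^ i) ^ (s / (i + 1)) := by
  have hc1 : ν' ^ i ≤ 1 := pow_le_one₀ hν0.le hν1
  have hc0 : 0 < ν' ^ i := pow_pos hν0 i
  have hτ' : τ * Fintype.card V ≤ d := by
    have := mul_nonneg hν0.le (Nat.cast_nonneg (Fintype.card V) : (0 : ℝ) ≤ _)
    linarith
  refine (walkMatrix_mixing hd m hν0 hτ' (expansion_of_robustExpander hd hexp hν hτ) hi t x y).trans
    (mul_le_mul_of_nonneg_left ?_ (by positivity))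
  exact pow_le_pow_of_le_one (by linarith) (by linarith) (Nat.div_le_div_right ht)

lemma exists_forall_pow_mul_pow_div_le {ρ x : ℝ} (hρ0 : 0 < ρ) (hρ1 : ρ < 1) (hx : 0 < x)
    (k i : ℕ) : ∃ T : ℕ, ∀ t ≥ T, ((t : ℝ) + 1) ^ k * ρ ^ ((t + 1) / (i + 1)) ≤ x := by
  have h := tendsto_pow_const_mul_const_pow_of_abs_lt_one k
    (show |ρ| < 1 by rwa [abs_of_pos hρ0])
  obtain ⟨Q, hQ⟩ := Filter.eventually_atTop.1
    (h.eventually_le_const (show 0 < x * ρ / ((i : ℝ) + 1) ^ k by positivity))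
  refine ⟨Q * (i + 1), fun t ht => ?_⟩
  set q := (t + 1) / (i + 1) with hq
  have h1 : Q ≤ q := (Nat.le_div_iff_mul_le (by omega)).2 (by omega)
  have h2 : t + 1 ≤ (i + 1) * (q + 1) := (Nat.lt_mul_div_succ (t + 1) (by omega)).le
  have h2' : (t : ℝ) + 1 ≤ (i + 1) * (q + 1) := by exact_mod_cast h2
  have h3 := hQ (q + 1) (by omega)
  rw [le_div_iff₀ (by positivity)] at h3
  push_cast at h3
  refine le_of_mul_le_mul_right (le_trans ?_ h3) hρ0
  calc ((t : ℝ) + 1) ^ k * ρ ^ q * ρ ≤ ((i + 1) * (q + 1)) ^ k * ρ ^ q * ρ := by gcongr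
    _ = _ := by rw [mul_pow]; ring

lemma exists_threshold {δ ω ρ : ℝ} (hδ : 0 < δ) (hω : 0 < ω) (hρ0 : 0 < ρ) (hρ1 : ρ < 1) (i : ℕ) :
    ∃ T : ℕ, ∀ t ≥ T, 1 ≤ t ∧
      ρ ^ ((t + 1) / (i + 1)) * ((t : ℝ) + 1) ^ 50 ≤ ω / (4 * (t : ℝ) ^ 2) ∧
      ((t : ℝ) + 2) * (2 * (t + 2) + 2 * (t : ℝ) ^ 2 + 2 * t) ≤
        ω / (4 * (t : ℝ) ^ 2) * δ ^ 2 * (t : ℝ) ^ 50 ∧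
      4 * (t : ℝ) ^ 2 ≤ ω / (4 * (t : ℝ) ^ 2) * (t : ℝ) ^ 50 ∧
      (t : ℝ) / δ ≤ ω * ((t : ℝ) ^ 2 + 1) := by
  obtain ⟨T, hT⟩ := exists_forall_pow_mul_pow_div_le hρ0 hρ1 (show 0 < ω / 4 by positivity) 52 i
  refine ⟨max 1 (max T (max ⌈120 / (ω * δ ^ 2)⌉₊ (max ⌈16 / ω⌉₊ ⌈1 / (δ * ω)⌉₊))), fun t ht => ?_⟩
  simp only [ge_iff_le, max_le_iff, Nat.ceil_le] at ht
  obtain ⟨h1, h2, h3, h4, h5⟩ := ht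
  have h1' : (1 : ℝ) ≤ t := by exact_mod_cast h1
  have ht0 : (0 : ℝ) < t := by linarith
  have h6 := hT t h2
  rw [div_le_iff₀ (by positivity)] at h3 h4 h5
  have hpow : ∀ j ≤ 50, (t : ℝ) ^ j ≤ (t : ℝ) ^ 50 := fun j hj => pow_le_pow_right₀ h1' hj
  refine ⟨h1, ?_, ?_, ?_, ?_⟩
  · rw [le_div_iff₀ (by positivity)]
    have h7 : (t : ℝ) ^ 2 ≤ (t + 1) ^ 2 := by gcongr; linarith
    have h8 := mul_le_mul_of_nonneg_left h7
      (show 0 ≤ ((t : ℝ) + 1) ^ 50 * ρ ^ ((t + 1) / (i + 1)) by positivity)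
    calc ρ ^ ((t + 1) / (i + 1)) * ((t : ℝ) + 1) ^ 50 * (4 * t ^ 2)
        = 4 * (((t : ℝ) + 1) ^ 50 * ρ ^ ((t + 1) / (i + 1)) * t ^ 2) := by ring
      _ ≤ 4 * (((t : ℝ) + 1) ^ 50 * ρ ^ ((t + 1) / (i + 1)) * (t + 1) ^ 2) := by linarith
      _ = 4 * (((t : ℝ) + 1) ^ 52 * ρ ^ ((t + 1) / (i + 1))) := by ring
      _ ≤ ω := by linarith
  · rw [div_mul_eq_mul_div, div_mul_eq_mul_div, le_div_iff₀ (by positivity)]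
    calc ((t : ℝ) + 2) * (2 * (t + 2) + 2 * (t : ℝ) ^ 2 + 2 * t) * (4 * t ^ 2)
        ≤ (3 * (t : ℝ)) * (10 * (t : ℝ) ^ 2) * (4 * (t : ℝ) ^ 2) := by
          gcongr
          · linarith
          · nlinarith
      _ = 120 * (t : ℝ) ^ 5 := by ring
      _ ≤ t * (ω * δ ^ 2) * t ^ 5 := by gcongr
      _ = ω * δ ^ 2 * t ^ 6 := by ring
      _ ≤ _ := mul_le_mul_of_nonneg_left (hpow 6 (by norm_num)) (by positivity)
  · rw [div_mul_eq_mul_div, le_div_iff₀ (by positivity)]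
    calc 4 * (t : ℝ) ^ 2 * (4 * t ^ 2) = 16 * t ^ 4 := by ring
      _ ≤ t * ω * t ^ 4 := by gcongr
      _ = ω * t ^ 5 := by ring
      _ ≤ _ := mul_le_mul_of_nonneg_left (hpow 5 (by norm_num)) hω.le
  · rw [div_le_iff₀ hδ]
    calc (t : ℝ) = t * 1 := (mul_one _).symm
      _ ≤ t * (t * (δ * ω)) := by gcongr
      _ ≤ t * (t * (δ * ω)) + ω * δ := by have := mul_pos hω hδ; linarith
      _ = _ := by ring

end Assembly

/-- For a uniformly random perfect matching `M` of a `d`-regular robust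
`(ν,τ)`-expander `G` and a fixed spanning `r`-regular subgraph `N` of `G` with
`r ≤ n^{1/50}`, the number of edges of `N` in `M` is within total variation distance `ε`
of a Poisson distribution with mean `rn/(2d)`. -/
theorem poisson_approximation_spanning_regular :
    ∀ δ : ℝ, 0 < δ →
    ∃ τ : ℝ, 0 < τ ∧
    ∀ ν : ℝ, 0 < ν →
    ∀ ε : ℝ, 0 < ε →
    ∃ n₀ : ℕ, ∀ n : ℕ, n₀ ≤ n → Even n →
    ∀ d : ℕ, δ * (n : ℝ) ≤ (d : ℝ) →
    ∀ r : ℕ, 1 ≤ r → (r : ℝ) ≤ (n : ℝ) ^ ((1 : ℝ) / 50) →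
    ∀ (V : Type) [Fintype V] [DecidableEq V], Fintype.card V = n →
    ∀ G : SimpleGraph V, RegularDeg G d → RobustExpander G ν τ →
    pmCount G ≠ 0 →
    ∀ N : Finset (Sym2 V), SpanningRegular G N r →
      (1 / 2) * ∑' k : ℕ,
          |interProb G N k - poissonPMF ((r : ℝ) * (n : ℝ) / (2 * (d : ℝ))) k| ≤ ε := by
  intro δ hδ
  refine ⟨δ / 2, by positivity, fun ν hν ε hε => ?_⟩
  obtain ⟨ν', hν'0, hν'ν, hν'δ, hν'1⟩ : ∃ ν' : ℝ, 0 < ν' ∧ ν' ≤ ν ∧ ν' ≤ δ / 2 ∧ ν' ≤ 1 / 2 :=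
    ⟨min ν (min (δ / 2) (1 / 2)), by positivity, min_le_left _ _,
      (min_le_right _ _).trans (min_le_left _ _), (min_le_right _ _).trans (min_le_right _ _)⟩
  obtain ⟨ω, hω0, hωε, hω1⟩ : ∃ ω : ℝ, 0 < ω ∧ ω ≤ ε / 4 ∧ ω ≤ 1 / 4 :=
    ⟨min (ε / 4) (1 / 4), by positivity, min_le_left _ _, min_le_right _ _⟩
  obtain ⟨i, hi⟩ : ∃ i : ℕ, 1 ≤ i * ν' :=
    ⟨⌈1 / ν'⌉₊, (div_le_iff₀ hν'0).1 (Nat.le_ceil _)⟩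
  have hi0 : i ≠ 0 := by
    rintro rfl
    norm_num at hi
  have hρ1 : 1 - ν' ^ i < 1 := by linarith [pow_pos hν'0 i]
  have hρ0 : 0 < 1 - ν' ^ i := by linarith [pow_lt_one₀ hν'0.le (by linarith) hi0]
  obtain ⟨T, hT⟩ := exists_threshold hδ hω0 hρ0 hρ1 i
  refine ⟨max 1 (T ^ 50), ?_⟩
  rintro _ hn - d hd r hr hrn V _ _ rfl G hG hexp hpm N hN
  set n := Fintype.card V with hndef
  obtain ⟨hn1, hnT⟩ := max_le_iff.1 hn
  have hn0 : (0 : ℝ) < n := Nat.cast_pos.2 hn1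
  have hroot : ((n : ℝ) ^ ((1 : ℝ) / 50)) ^ 50 = n := by
    rw [← Real.rpow_natCast, ← Real.rpow_mul hn0.le]
    norm_num
  have hroot0 : 0 ≤ (n : ℝ) ^ ((1 : ℝ) / 50) := by positivity
  obtain ⟨t, ht⟩ : ∃ t : ℕ, t = ⌊(n : ℝ) ^ ((1 : ℝ) / 50)⌋₊ := ⟨_, rfl⟩
  have htn : (t : ℝ) ^ 50 ≤ n := by
    rw [← hroot, ht]
    exact pow_le_pow_left₀ (Nat.cast_nonneg _) (Nat.floor_le hroot0) 50
  have hnt : (n : ℝ) ≤ ((t : ℝ) + 1) ^ 50 := by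
    rw [← hroot, ht]
    exact pow_le_pow_left₀ hroot0 (Nat.lt_floor_add_one _).le 50
  have hrt : (r : ℝ) ≤ t := by
    rw [ht]
    exact_mod_cast Nat.le_floor hrn
  have hTt : T ≤ t := by
    rw [ht]
    refine Nat.le_floor (le_of_pow_le_pow_left₀ (n := 50) (by norm_num) hroot0 ?_)
    rw [hroot]
    exact_mod_cast hnT
  obtain ⟨ht1, hexpo, hwalks, hlevels, htail⟩ := hT t hTt
  have ht1' : (1 : ℝ) ≤ t := by exact_mod_cast ht1
  have hd0' : (0 : ℝ) < d := lt_of_lt_of_le (by positivity) hd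
  have hd0 : 0 < d := by exact_mod_cast hd0'
  set κ := ω / (4 * (t : ℝ) ^ 2) with hκdef
  have hκ0 : 0 ≤ κ := by positivity
  have hκ : (t : ℝ) ^ 2 * (4 * κ) = ω := by rw [hκdef]; field_simp
  have hd' := card_neighbors_of_regularDeg hG
  refine (tsum_abs_interProb_sub_le (s := t) (K := t ^ 2)
    (e := (1 - ν' ^ i) ^ ((t + 1) / (i + 1))) (κ := κ) (ω := ω) ht1 hd' hN hr
    (walkMatrix_mixing_of_robustExpander hd' hexp hν'ν hν'0 (by linarith) ?_ hi) hn1 hd0 hpm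
    (Nat.one_le_pow _ _ ht1) hκ0 ?_ ?_ ?_ ?_ hω1 ?_ ?_).trans (by linarith)
  · exact le_trans (mul_le_mul_of_nonneg_right (by linarith) hn0.le) hd
  · nlinarith
  · exact le_trans (mul_le_mul_of_nonneg_left hnt (by positivity)) hexpo
  · push_cast
    have hnd : (δ * n) ^ 2 ≤ (d : ℝ) ^ 2 := by gcongr
    calc ((t : ℝ) + 2) * (2 * (t + 2) + 2 * (t : ℝ) ^ 2 + 2 * r) * n
        ≤ ((t : ℝ) + 2) * (2 * (t + 2) + 2 * (t : ℝ) ^ 2 + 2 * t) * n := by gcongr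
      _ ≤ κ * δ ^ 2 * (t : ℝ) ^ 50 * n := by gcongr
      _ ≤ κ * δ ^ 2 * n * n := by gcongr
      _ = κ * (δ * n) ^ 2 := by ring
      _ ≤ κ * (d : ℝ) ^ 2 := by gcongr
  · push_cast
    exact hlevels.trans (by gcongr)
  · push_cast
    exact hκ.le
  · push_cast
    calc 2 * ((r : ℝ) * n / (2 * d)) = r * (n / d) := by field_simp
      _ ≤ t * (1 / δ) := by
        refine mul_le_mul hrt ?_ (by positivity) (by positivity)
        rw [div_le_div_iff₀ hd0' hδ]
        linarith
      _ = t / δ := by ring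
      _ ≤ _ := htail

end RPM
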